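/- arXiv:2211.02015 — 3 statements merged into one kernel-verified Lean document; each statement's English description precedes it below -/
import Mathlib

section
/- If n is sufficiently large, then any properly edge-coloured n-vertex graph with at least 8·n·(log n)² edges contains a rainbow cycle, that is, a cycle in which all edges have pairwise distinct colours. -/
open SimpleGraph

/-- An edge-colouring `c` of (the edges of) `G` is proper if any two distinct edges
sharing a vertex receive different colours. -/
def IsProperEdgeColoring {V β : Type} (G : SimpleGraph V) (c : Sym2 V → β) : Prop :=
  ∀ ⦃e₁ e₂ : Sym2 V⦄, e₁ ∈ G.edgeSet → e₂ ∈ G.edgeSet → e₁ ≠ e₂ →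
    (∃ v, v ∈ e₁ ∧ v ∈ e₂) → c e₁ ≠ c e₂

section NoncommutativeSums

variable {R β : Type*} [Ring R]

/-- The sum of `N ^ i * X * N ^ j` over all `i + j + 1 = m`. -/
def hitSum (N X : R) : ℕ → R
  | 0 => 0
  | m + 1 => X * N ^ m + N * hitSum N X m

/-- The sum of `N ^ i * W b * N ^ j * W b * N ^ l` over all `b ∈ S` and `i + j + l + 2 = m`,
where `N` is the sum of `W` over `S`. -/
def repeatSum (S : Finset β) (W : β → R) : ℕ → R
  | 0 => 0
  | m + 1 => ∑ b ∈ S, W b * hitSum (∑ b ∈ S, W b) (W b) m + (∑ b ∈ S, W b) * repeatSum S W m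

variable [DecidableEq β]

/-- The sum of the products `W b₁ * ⋯ * W bₘ` over all words of length `m` in pairwise distinct
letters of `S \ F`. -/
def rainbowSum (S : Finset β) (W : β → R) : ℕ → Finset β → R
  | 0, _ => 1
  | m + 1, F => ∑ b ∈ S \ F, W b * rainbowSum S W m (insert b F)

/-- An upper bound for the `m`-th power of the sum of `W` over `S`: every word of length `m` is
rainbow and avoids `F`, or hits a letter of `F`, or repeats a letter. -/
def powMajorant (S : Finset β) (W : β → R) (m : ℕ) (F : Finset β) : R :=
  rainbowSum S W m F + ∑ b ∈ F, hitSum (∑ b ∈ S, W b) (W b) m + repeatSum S W m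

theorem powMajorant_succ_sub_pow (S : Finset β) (W : β → R) (m : ℕ) {F : Finset β} (hF : F ⊆ S) :
    powMajorant S W (m + 1) F - (∑ b ∈ S, W b) ^ (m + 1) =
      ∑ b ∈ S \ F, W b * (powMajorant S W m (insert b F) - (∑ b ∈ S, W b) ^ m) +
        (∑ b ∈ F, W b) * ∑ b ∈ F, hitSum (∑ b ∈ S, W b) (W b) m +
        ∑ b ∈ F, W b * hitSum (∑ b ∈ S, W b) (W b) m +
        (∑ b ∈ F, W b) * repeatSum S W m := by
  have hN : ∑ b ∈ S, W b = ∑ b ∈ S \ F, W b + ∑ b ∈ F, W b := (Finset.sum_sdiff hF).symm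
  have hsplit : ∑ b ∈ S, W b * hitSum (∑ b ∈ S, W b) (W b) m =
      ∑ b ∈ S \ F, W b * hitSum (∑ b ∈ S, W b) (W b) m +
        ∑ b ∈ F, W b * hitSum (∑ b ∈ S, W b) (W b) m := (Finset.sum_sdiff hF).symm
  have hins : ∑ b ∈ S \ F, W b * (powMajorant S W m (insert b F) - (∑ b ∈ S, W b) ^ m) =
      ∑ b ∈ S \ F, (W b * rainbowSum S W m (insert b F) + W b * hitSum (∑ b ∈ S, W b) (W b) m +
        W b * (∑ b ∈ F, hitSum (∑ b ∈ S, W b) (W b) m + repeatSum S W m -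
          (∑ b ∈ S, W b) ^ m)) := by
    refine Finset.sum_congr rfl fun b hb => ?_
    rw [powMajorant, Finset.sum_insert (Finset.mem_sdiff.1 hb).2]
    noncomm_ring
  rw [hins, Finset.sum_add_distrib, Finset.sum_add_distrib, ← Finset.sum_mul, powMajorant,
    rainbowSum, repeatSum, hsplit]
  simp only [hitSum]
  rw [Finset.sum_add_distrib, ← Finset.sum_mul, ← Finset.mul_sum, pow_succ']
  generalize ∑ b ∈ F, hitSum (∑ b ∈ S, W b) (W b) m = A
  generalize ∑ b ∈ F, W b * hitSum (∑ b ∈ S, W b) (W b) m = B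
  generalize ∑ b ∈ S \ F, W b * hitSum (∑ b ∈ S, W b) (W b) m = D
  generalize (∑ b ∈ S, W b) ^ m = E
  rw [hN]
  noncomm_ring

end NoncommutativeSums

section Matrices

open Matrix

variable {V β : Type*}

theorem Matrix.mul_apply_nonneg [Fintype V] {A B : Matrix V V ℝ} (hA : ∀ i j, 0 ≤ A i j)
    (hB : ∀ i j, 0 ≤ B i j) (i j : V) : 0 ≤ (A * B) i j :=
  Finset.sum_nonneg fun l _ => mul_nonneg (hA i l) (hB l j)

theorem Matrix.sum_apply_nonneg {S : Finset β} {A : β → Matrix V V ℝ}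
    (hA : ∀ b ∈ S, ∀ i j, 0 ≤ A b i j) (i j : V) : 0 ≤ (∑ b ∈ S, A b) i j := by
  rw [Matrix.sum_apply]
  exact Finset.sum_nonneg fun b hb => hA b hb i j

variable [Fintype V] [DecidableEq V]

theorem Matrix.pow_apply_nonneg_of_nonneg {A : Matrix V V ℝ} (hA : ∀ i j, 0 ≤ A i j) (m : ℕ) (i j : V) :
    0 ≤ (A ^ m) i j := by
  induction m generalizing i j with
  | zero =>
    rw [pow_zero, Matrix.one_apply]
    split_ifs <;> norm_num
  | succ m ih => exact pow_succ A m ▸ mul_apply_nonneg ih hA i j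

theorem hitSum_apply_nonneg {N X : Matrix V V ℝ} (hN : ∀ i j, 0 ≤ N i j)
    (hX : ∀ i j, 0 ≤ X i j) (m : ℕ) (i j : V) : 0 ≤ hitSum N X m i j := by
  induction m generalizing i j with
  | zero => exact le_rfl
  | succ m ih =>
    exact add_nonneg (mul_apply_nonneg hX (pow_apply_nonneg_of_nonneg hN m) i j)
      (mul_apply_nonneg hN ih i j)

theorem sum_trace_hitSum_le {S : Finset β} {W : β → Matrix V V ℝ} {N : Matrix V V ℝ} {K : ℝ}
    {L : ℕ} (hK : ∀ a b, a + b = L → ∑ c ∈ S, (W c * N ^ a * (W c * N ^ b)).trace ≤ K)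
    (m p q : ℕ) (h : p + q + m = L + 1) :
    ∑ c ∈ S, (N ^ p * W c * N ^ q * hitSum N (W c) m).trace ≤ m * K := by
  induction m generalizing q with
  | zero => simp [hitSum]
  | succ m ih =>
    have key : ∀ c, (N ^ p * W c * N ^ q * hitSum N (W c) (m + 1)).trace =
        (W c * N ^ q * (W c * N ^ (m + p))).trace +
          (N ^ p * W c * N ^ (q + 1) * hitSum N (W c) m).trace := fun c => by
      rw [hitSum, mul_add, trace_add, pow_add, pow_succ]
      congr 1
      · rw [mul_assoc (N ^ p), mul_assoc (N ^ p), trace_mul_comm]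
        simp only [mul_assoc]
      · simp only [mul_assoc]
    simp only [key, Finset.sum_add_distrib]
    have h1 := hK q (m + p) (by omega)
    have h2 := ih (q + 1) (by omega)
    push_cast
    linarith

theorem repeatSum_apply_nonneg {S : Finset β} {W : β → Matrix V V ℝ}
    (hW : ∀ b i j, 0 ≤ W b i j) (m : ℕ) (i j : V) : 0 ≤ repeatSum S W m i j := by
  have hN := sum_apply_nonneg (S := S) fun b _ => hW b
  induction m generalizing i j with
  | zero => exact le_rfl
  | succ m ih =>
    exact add_nonneg
      (sum_apply_nonneg (fun b _ => mul_apply_nonneg (hW b) (hitSum_apply_nonneg hN (hW b) m)) i j)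
      (mul_apply_nonneg hN ih i j)

theorem trace_repeatSum_le {S : Finset β} {W : β → Matrix V V ℝ} {K : ℝ} {L : ℕ}
    (hK : ∀ a b, a + b = L →
      ∑ c ∈ S, (W c * (∑ c ∈ S, W c) ^ a * (W c * (∑ c ∈ S, W c) ^ b)).trace ≤ K)
    (m p : ℕ) (h : p + m = L + 2) :
    ((∑ c ∈ S, W c) ^ p * repeatSum S W m).trace ≤ m * (m - 1) / 2 * K := by
  induction m generalizing p with
  | zero => simp [repeatSum]
  | succ m ih =>
    have h1 := sum_trace_hitSum_le hK m p 0 (by omega)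
    have h2 := ih (p + 1) (by omega)
    rw [pow_succ, mul_assoc] at h2
    rw [repeatSum, mul_add, trace_add, Finset.mul_sum, trace_sum]
    simp only [pow_zero, mul_one, mul_assoc] at h1 ⊢
    push_cast
    linarith

variable [DecidableEq β]

theorem powMajorant_sub_pow_apply_nonneg {S : Finset β} {W : β → Matrix V V ℝ}
    (hW : ∀ b i j, 0 ≤ W b i j) (m : ℕ) {F : Finset β} (hF : F ⊆ S) (i j : V) :
    0 ≤ (powMajorant S W m F - (∑ b ∈ S, W b) ^ m) i j := by
  have hN := sum_apply_nonneg (S := S) fun b _ => hW b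
  have hP := sum_apply_nonneg (S := F) fun b _ => hW b
  induction m generalizing F i j with
  | zero => simp [powMajorant, rainbowSum, hitSum, repeatSum]
  | succ m ih =>
    rw [powMajorant_succ_sub_pow S W m hF]
    refine add_nonneg (add_nonneg (add_nonneg ?_ ?_) ?_) ?_
    · refine sum_apply_nonneg (fun b hb => mul_apply_nonneg (hW b) fun i j => ih ?_ i j ?_) i j
      · exact Finset.insert_subset (Finset.mem_sdiff.1 hb).1 hF
      · exact sum_apply_nonneg fun b _ => hW b
    · exact mul_apply_nonneg hP
        (sum_apply_nonneg fun b _ => hitSum_apply_nonneg hN (hW b) m) i j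
    · exact sum_apply_nonneg
        (fun b _ => mul_apply_nonneg (hW b) (hitSum_apply_nonneg hN (hW b) m)) i j
    · exact mul_apply_nonneg hP (repeatSum_apply_nonneg hW m) i j

end Matrices

section Spectral

open Matrix

variable {V : Type*} [Fintype V] [DecidableEq V]

theorem Matrix.IsHermitian.exists_pow_eq {N : Matrix V V ℝ} (hN : N.IsHermitian) :
    ∃ U : Matrix V V ℝ, Uᵀ * U = 1 ∧ U * Uᵀ = 1 ∧
      ∀ m : ℕ, N ^ m = U * diagonal (fun i => hN.eigenvalues i ^ m) * Uᵀ := by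
  refine ⟨hN.eigenvectorUnitary, ?_, ?_, fun m => ?_⟩
  · simpa [star_eq_conjTranspose] using Unitary.coe_star_mul_self hN.eigenvectorUnitary
  · simpa [star_eq_conjTranspose] using Unitary.coe_mul_star_self hN.eigenvectorUnitary
  · conv_lhs => rw [hN.spectral_theorem, ← map_pow, diagonal_pow]
    rw [Unitary.conjStarAlgAut_apply]
    simp [star_eq_conjTranspose, Pi.pow_def]

theorem Matrix.IsHermitian.trace_pow {N : Matrix V V ℝ} (hN : N.IsHermitian) (m : ℕ) :
    (N ^ m).trace = ∑ i, hN.eigenvalues i ^ m := by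
  obtain ⟨U, hU, -, hpow⟩ := hN.exists_pow_eq
  rw [hpow, trace_mul_comm, ← mul_assoc, hU, one_mul, trace_diagonal]

theorem Matrix.trace_mul_diagonal_mul_mul_diagonal (B : Matrix V V ℝ) (x y : V → ℝ) :
    (B * diagonal x * (B * diagonal y)).trace = ∑ i, ∑ j, B i j * B j i * (x j * y i) := by
  simp only [trace, diag_apply, mul_apply (M := B * diagonal x), mul_diagonal]
  exact Finset.sum_congr rfl fun i _ => Finset.sum_congr rfl fun j _ => by ring

theorem pow_mul_pow_add_pow_mul_pow_le (x y : ℝ) {a b : ℕ} (hab : Even (a + b)) :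
    x ^ a * y ^ b + x ^ b * y ^ a ≤ x ^ (a + b) + y ^ (a + b) := by
  have h : ∀ x y : ℝ, 0 ≤ x → 0 ≤ y →
      x ^ a * y ^ b + x ^ b * y ^ a ≤ x ^ (a + b) + y ^ (a + b) := fun x y hx hy => by
    rw [pow_add, pow_add]
    rcases le_total x y with hxy | hxy
    · nlinarith [mul_nonneg (sub_nonneg.2 (pow_le_pow_left₀ hx hxy a))
        (sub_nonneg.2 (pow_le_pow_left₀ hx hxy b))]
    · nlinarith [mul_nonneg (sub_nonneg.2 (pow_le_pow_left₀ hy hxy a))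
        (sub_nonneg.2 (pow_le_pow_left₀ hy hxy b))]
  calc x ^ a * y ^ b + x ^ b * y ^ a ≤ |x ^ a * y ^ b| + |x ^ b * y ^ a| :=
        add_le_add (le_abs_self _) (le_abs_self _)
    _ = |x| ^ a * |y| ^ b + |x| ^ b * |y| ^ a := by simp only [abs_mul, abs_pow]
    _ ≤ |x| ^ (a + b) + |y| ^ (a + b) := h _ _ (abs_nonneg x) (abs_nonneg y)
    _ = x ^ (a + b) + y ^ (a + b) := by rw [hab.pow_abs, hab.pow_abs]

/-- Two occurrences of a symmetric matrix in a closed word of even length in a Hermitian matrix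
contribute the most to the trace when they are adjacent. -/
theorem Matrix.IsHermitian.trace_mul_pow_mul_mul_pow_le {N W : Matrix V V ℝ} (hN : N.IsHermitian)
    (hW : Wᵀ = W) {a b : ℕ} (hab : Even (a + b)) :
    (W * N ^ a * (W * N ^ b)).trace ≤ (W * W * N ^ (a + b)).trace := by
  obtain ⟨U, -, hU, hpow⟩ := hN.exists_pow_eq
  set B := Uᵀ * W * U with hB
  have hBsymm : ∀ i j, B j i = B i j := fun i j => by
    have : Bᵀ = B := by simp only [hB, transpose_mul, transpose_transpose, hW, mul_assoc]
    exact congrFun (congrFun this i) j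
  have key : ∀ p q : ℕ, (W * N ^ p * (W * N ^ q)).trace =
      ∑ i, ∑ j, B i j ^ 2 * (hN.eigenvalues j ^ p * hN.eigenvalues i ^ q) := fun p q => by
    have h1 : W * N ^ p * (W * N ^ q) = U * (B * diagonal (fun i => hN.eigenvalues i ^ p) *
        (B * diagonal (fun i => hN.eigenvalues i ^ q))) * Uᵀ := by
      have h2 : ∀ M, U * (Uᵀ * M) = M := fun M => by rw [← mul_assoc, hU, one_mul]
      rw [hpow, hpow, hB]
      simp only [mul_assoc, h2]
    have h3 : Uᵀ * U = 1 := mul_eq_one_comm.1 hU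
    rw [h1, trace_mul_comm, ← mul_assoc, h3, one_mul, trace_mul_diagonal_mul_mul_diagonal]
    exact Finset.sum_congr rfl fun i _ => Finset.sum_congr rfl fun j _ => by
      rw [hBsymm i j]; ring
  have hswap : ∀ p q : ℕ, 2 * (W * N ^ p * (W * N ^ q)).trace =
      ∑ i, ∑ j, B i j ^ 2 * (hN.eigenvalues j ^ p * hN.eigenvalues i ^ q +
        hN.eigenvalues j ^ q * hN.eigenvalues i ^ p) := fun p q => by
    have h1 := key p q
    rw [Finset.sum_comm] at h1
    rw [two_mul]
    nth_rewrite 1 [key p q]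
    rw [h1, ← Finset.sum_add_distrib]
    refine Finset.sum_congr rfl fun i _ => ?_
    rw [← Finset.sum_add_distrib]
    exact Finset.sum_congr rfl fun j _ => by rw [hBsymm i j]; ring
  have h0 : W * W * N ^ (a + b) = W * N ^ 0 * (W * N ^ (a + b)) := by
    rw [pow_zero, mul_one, mul_assoc]
  suffices 2 * (W * N ^ a * (W * N ^ b)).trace ≤ 2 * (W * W * N ^ (a + b)).trace by linarith
  rw [h0, hswap, hswap]
  refine Finset.sum_le_sum fun i _ => Finset.sum_le_sum fun j _ =>
    mul_le_mul_of_nonneg_left ?_ (sq_nonneg _)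
  have := pow_mul_pow_add_pow_mul_pow_le (hN.eigenvalues j) (hN.eigenvalues i) hab
  simpa [add_comm] using this

theorem succ_mul_pow_le {s : ℝ} (hs : 0 ≤ s) (k : ℕ) : (k + 1) * s ^ k ≤ k * s ^ (k + 1) + 1 := by
  induction k with
  | zero => simp
  | succ k ih =>
    push_cast
    have h1 := mul_le_mul_of_nonneg_left ih hs
    rcases le_total s 1 with h | h
    · have h2 : s ^ (k + 1) ≤ 1 := pow_le_one₀ hs h
      have h3 := mul_nonneg (sub_nonneg.2 h) (sub_nonneg.2 h2)
      ring_nf at *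
      nlinarith
    · have h2 : 1 ≤ s ^ (k + 1) := one_le_pow₀ h
      have h3 := mul_nonneg (sub_nonneg.2 h) (sub_nonneg.2 h2)
      ring_nf at *
      nlinarith

theorem Matrix.IsHermitian.trace_pow_le_mul_trace_pow {N : Matrix V V ℝ} (hN : N.IsHermitian)
    {C : ℝ} (hC : 0 < C) {k : ℕ} (hV : (Fintype.card V : ℝ) ≤ C ^ (k + 1))
    (h1 : 1 ≤ (N ^ (2 * (k + 1))).trace) :
    (N ^ (2 * k)).trace ≤ C * (N ^ (2 * (k + 1))).trace := by
  have hsum : (k + 1) * C ^ k * (N ^ (2 * k)).trace ≤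
      k * C ^ (k + 1) * (N ^ (2 * (k + 1))).trace + Fintype.card V := by
    rw [hN.trace_pow, hN.trace_pow, Finset.mul_sum, Finset.mul_sum, ← Finset.card_univ,
      Finset.cast_card, ← Finset.sum_add_distrib]
    refine Finset.sum_le_sum fun i _ => ?_
    have := succ_mul_pow_le (mul_nonneg hC.le (sq_nonneg (hN.eigenvalues i))) k
    rw [mul_pow, mul_pow, ← pow_mul, ← pow_mul] at this
    linarith
  have hpos : 0 < (k + 1) * C ^ k := by positivity
  have hT : C ^ (k + 1) * 1 ≤ C ^ (k + 1) * (N ^ (2 * (k + 1))).trace :=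
    mul_le_mul_of_nonneg_left h1 (by positivity)
  refine le_of_mul_le_mul_left ?_ hpos
  calc _ ≤ _ := hsum
    _ ≤ k * C ^ (k + 1) * (N ^ (2 * (k + 1))).trace +
        C ^ (k + 1) * (N ^ (2 * (k + 1))).trace := by linarith
    _ = _ := by ring

theorem Matrix.IsHermitian.one_le_trace_pow {N : Matrix V V ℝ} (hN : N.IsHermitian) {x : V → ℝ}
    (hx : x ≠ 0) (hNx : N *ᵥ x = x) (k : ℕ) : 1 ≤ (N ^ (2 * k)).trace := by
  have hmem : (1 : ℝ) ∈ spectrum ℝ N := by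
    rw [← Matrix.spectrum_toLin']
    refine Module.End.HasEigenvalue.mem_spectrum
      (Module.End.hasEigenvalue_of_hasEigenvector (x := x) ⟨?_, hx⟩)
    rw [Module.End.mem_eigenspace_iff, Matrix.toLin'_apply, hNx, one_smul]
  rw [hN.spectrum_real_eq_range_eigenvalues] at hmem
  obtain ⟨i, hi⟩ := hmem
  rw [hN.trace_pow]
  calc (1 : ℝ) = hN.eigenvalues i ^ (2 * k) := by rw [hi, one_pow]
    _ ≤ _ := Finset.single_le_sum (f := fun i => hN.eigenvalues i ^ (2 * k))
      (fun i _ => (even_two_mul k).pow_nonneg _) (Finset.mem_univ i)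

end Spectral

section Graphs

open Matrix

variable {V β : Type} {G : SimpleGraph V} {c : Sym2 V → β}

theorem IsProperEdgeColoring.mono {H : SimpleGraph V} (hc : IsProperEdgeColoring G c)
    (h : H ≤ G) : IsProperEdgeColoring H c :=
  fun _ _ h₁ h₂ => hc (edgeSet_mono h h₁) (edgeSet_mono h h₂)

theorem IsProperEdgeColoring.eq_of_color_eq (hc : IsProperEdgeColoring G c) {u v w : V}
    (huw : G.Adj u w) (hwv : G.Adj w v) (h : c s(u, w) = c s(w, v)) : u = v := by
  by_contra huv
  refine hc (e₁ := s(u, w)) (e₂ := s(w, v)) huw hwv ?_ ⟨w, by simp, by simp⟩ h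
  intro he
  rw [Sym2.eq_swap, Sym2.congr_right] at he
  exact huv he

/-- A nonempty closed walk with pairwise distinct colours contains a rainbow cycle. -/
theorem SimpleGraph.Walk.exists_rainbow_isCycle {v : V} (w : G.Walk v v) (hw : w.length ≠ 0)
    (hnodup : (w.edges.map c).Nodup) :
    ∃ (v : V) (w : G.Walk v v), w.IsCycle ∧ (w.edges.map c).Nodup := by
  classical
  refine ⟨v, w.cycleBypass, IsTrail.isCycle_cycleBypass ?_ ⟨hnodup.of_map c⟩,
    hnodup.sublist (w.edges_cycleBypass_sublist_edges.map c)⟩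
  rintro rfl
  exact hw rfl

variable [Fintype V]

open Classical in
variable (G c) in
/-- The part of the normalised adjacency matrix of `G` that lives on the edges of colour `b`. -/
noncomputable def colorMatrix (b : β) : Matrix V V ℝ :=
  Matrix.of fun u v =>
    if G.Adj u v ∧ c s(u, v) = b then (√(G.degree u))⁻¹ * (√(G.degree v))⁻¹ else 0

open Classical in
variable (G c) in
/-- The colours that occur on the edges of `G`. -/
noncomputable def usedColors : Finset β := G.edgeFinset.image c

theorem colorMatrix_apply_nonneg (b : β) (u v : V) : 0 ≤ colorMatrix G c b u v := by
  simp only [colorMatrix, of_apply]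
  split_ifs <;> positivity

theorem transpose_colorMatrix (b : β) : (colorMatrix G c b)ᵀ = colorMatrix G c b := by
  classical
  ext u v
  simp only [colorMatrix, transpose_apply, of_apply, G.adj_comm v u, Sym2.eq_swap (a := v) (b := u),
    mul_comm (√(G.degree v : ℝ))⁻¹]

theorem mem_usedColors {u v : V} (h : G.Adj u v) : c s(u, v) ∈ usedColors G c := by
  classical
  exact Finset.mem_image_of_mem c (by simpa using h)

open Classical in
theorem sum_colorMatrix_apply (u v : V) :
    (∑ b ∈ usedColors G c, colorMatrix G c b) u v =
      if G.Adj u v then (√(G.degree u))⁻¹ * (√(G.degree v))⁻¹ else 0 := by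
  rw [Matrix.sum_apply]
  simp only [colorMatrix, of_apply]
  by_cases h : G.Adj u v
  · simp [h, mem_usedColors h]
  · simp [h]

theorem isHermitian_sum_colorMatrix :
    (∑ b ∈ usedColors G c, colorMatrix G c b).IsHermitian := by
  rw [IsHermitian, conjTranspose_eq_transpose_of_trivial, transpose_sum]
  simp only [transpose_colorMatrix]

open Classical in
theorem sum_colorMatrix_mulVec_sqrt_degree :
    (∑ b ∈ usedColors G c, colorMatrix G c b) *ᵥ (fun v => √(G.degree v)) =
      fun v => √(G.degree v) := by
  ext u
  simp only [mulVec, dotProduct, sum_colorMatrix_apply]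
  have h : ∀ v, (if G.Adj u v then (√(G.degree u))⁻¹ * (√(G.degree v))⁻¹ else 0) *
      √(G.degree v) = if G.Adj u v then (√(G.degree u))⁻¹ else 0 := fun v => by
    split_ifs with huv
    · have : (0 : ℝ) < G.degree v := by
        exact_mod_cast (G.degree_pos_iff_exists_adj v).2 ⟨u, huv.symm⟩
      rw [mul_assoc, inv_mul_cancel₀ (Real.sqrt_pos.2 this).ne', mul_one]
    · exact zero_mul _
  simp only [h]
  rw [← Finset.sum_filter, Finset.sum_const, ← G.neighborFinset_eq_filter,
    G.card_neighborFinset_eq_degree, nsmul_eq_mul, ← div_eq_mul_inv, Real.div_sqrt]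

theorem sum_colorMatrix_sq_apply_of_ne (hc : IsProperEdgeColoring G c) {u v : V} (huv : u ≠ v) :
    (∑ b ∈ usedColors G c, colorMatrix G c b * colorMatrix G c b) u v = 0 := by
  rw [Matrix.sum_apply]
  refine Finset.sum_eq_zero fun b _ => ?_
  rw [mul_apply]
  refine Finset.sum_eq_zero fun w _ => ?_
  simp only [colorMatrix, of_apply]
  split_ifs with h1 h2 <;> try simp only [mul_zero, zero_mul]
  exact absurd (hc.eq_of_color_eq h1.1 h2.1 (h1.2.trans h2.2.symm)) huv

open Classical in
theorem sum_colorMatrix_sq_apply_self_le {d : ℝ} (hd : 0 < d)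
    (hdeg : ∀ v, G.degree v ≠ 0 → d ≤ G.degree v) (u : V) :
    (∑ b ∈ usedColors G c, colorMatrix G c b * colorMatrix G c b) u u ≤ d⁻¹ := by
  have h1 : ∀ b w, colorMatrix G c b u w * colorMatrix G c b w u =
      if c s(u, w) = b then if G.Adj u w then (G.degree u : ℝ)⁻¹ * (G.degree w : ℝ)⁻¹ else 0
      else 0 := fun b w => by
    have hs : colorMatrix G c b w u = colorMatrix G c b u w :=
      congrFun (congrFun (transpose_colorMatrix b) u) w
    rw [hs]
    simp only [colorMatrix, of_apply]
    by_cases h : G.Adj u w <;> by_cases h' : c s(u, w) = b <;> simp only [h, h', and_self,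
      and_true, and_false, if_true, if_false, mul_zero]
    rw [mul_mul_mul_comm, ← mul_inv, ← mul_inv, Real.mul_self_sqrt (Nat.cast_nonneg _),
      Real.mul_self_sqrt (Nat.cast_nonneg _)]
  have h2 : ∀ w, (∑ b ∈ usedColors G c, if c s(u, w) = b then
      if G.Adj u w then (G.degree u : ℝ)⁻¹ * (G.degree w : ℝ)⁻¹ else 0 else 0) ≤
      if G.Adj u w then (G.degree u : ℝ)⁻¹ * d⁻¹ else 0 := fun w => by
    rw [Finset.sum_ite_eq]
    split_ifs with hmem hadj hadj
    · have : G.degree w ≠ 0 := ((G.degree_pos_iff_exists_adj w).2 ⟨u, hadj.symm⟩).ne'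
      exact mul_le_mul_of_nonneg_left (inv_anti₀ hd (hdeg w this)) (by positivity)
    · exact le_rfl
    · positivity
    · exact le_rfl
  rw [Matrix.sum_apply]
  simp only [mul_apply, h1]
  rw [Finset.sum_comm]
  refine (Finset.sum_le_sum fun w _ => h2 w).trans ?_
  rw [← Finset.sum_filter, Finset.sum_const, ← G.neighborFinset_eq_filter,
    G.card_neighborFinset_eq_degree, nsmul_eq_mul, ← mul_assoc]
  exact mul_le_of_le_one_left (inv_nonneg.2 hd.le) (mul_inv_le_one (a := (G.degree u : ℝ)))

open Classical in
theorem sum_trace_colorMatrix_le (hc : IsProperEdgeColoring G c) {d : ℝ} (hd : 0 < d)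
    (hdeg : ∀ v, G.degree v ≠ 0 → d ≤ G.degree v) {a b : ℕ} (hab : Even (a + b)) :
    ∑ x ∈ usedColors G c, (colorMatrix G c x * (∑ x ∈ usedColors G c, colorMatrix G c x) ^ a *
      (colorMatrix G c x * (∑ x ∈ usedColors G c, colorMatrix G c x) ^ b)).trace ≤
      d⁻¹ * ((∑ x ∈ usedColors G c, colorMatrix G c x) ^ (a + b)).trace := by
  refine (Finset.sum_le_sum fun x _ => isHermitian_sum_colorMatrix.trace_mul_pow_mul_mul_pow_le
    (transpose_colorMatrix x) hab).trans ?_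
  rw [← trace_sum, ← Finset.sum_mul, trace, trace, Finset.mul_sum]
  refine Finset.sum_le_sum fun u _ => ?_
  rw [diag_apply, diag_apply, mul_apply, Finset.sum_eq_single u]
  · exact mul_le_mul_of_nonneg_right (sum_colorMatrix_sq_apply_self_le hd hdeg u)
      (pow_apply_nonneg_of_nonneg (sum_apply_nonneg fun x _ => colorMatrix_apply_nonneg x) _ u u)
  · intro v _ huv
    rw [sum_colorMatrix_sq_apply_of_ne hc huv.symm, zero_mul]
  · exact fun h => absurd (Finset.mem_univ u) h

open Classical in
theorem exists_walk_of_rainbowSum_ne_zero {S : Finset β} (m : ℕ) {F : Finset β} {u v : V}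
    (h : rainbowSum S (colorMatrix G c) m F u v ≠ 0) :
    ∃ w : G.Walk u v, w.length = m ∧ (w.edges.map c).Nodup ∧ ∀ b ∈ w.edges.map c, b ∉ F := by
  induction m generalizing F u with
  | zero =>
    rw [rainbowSum, Matrix.one_apply] at h
    obtain rfl : u = v := by
      by_contra huv
      exact h (if_neg huv)
    exact ⟨.nil, by simp⟩
  | succ m ih =>
    rw [rainbowSum, Matrix.sum_apply] at h
    obtain ⟨b, hb, hne⟩ := Finset.exists_ne_zero_of_sum_ne_zero h
    rw [mul_apply] at hne
    obtain ⟨x, -, hx⟩ := Finset.exists_ne_zero_of_sum_ne_zero hne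
    obtain ⟨w, hlen, hnodup, hF⟩ := ih (right_ne_zero_of_mul hx)
    have hW := left_ne_zero_of_mul hx
    simp only [colorMatrix, of_apply, ne_eq, ite_eq_right_iff, not_forall] at hW
    obtain ⟨⟨hadj, rfl⟩, -⟩ := hW
    refine ⟨.cons hadj w, by simp [hlen], ?_, ?_⟩
    · rw [SimpleGraph.Walk.edges_cons, List.map_cons, List.nodup_cons]
      exact ⟨fun hmem => hF _ hmem (Finset.mem_insert_self _ _), hnodup⟩
    · rw [SimpleGraph.Walk.edges_cons, List.map_cons]
      intro b' hb'
      rcases List.mem_cons.1 hb' with rfl | hb'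
      · exact (Finset.mem_sdiff.1 hb).2
      · exact fun hmem => hF b' hb' (Finset.mem_insert_of_mem hmem)

open Classical in
/-- A nonempty properly edge-coloured graph all of whose nonzero degrees are large contains a
rainbow cycle. -/
theorem exists_rainbow_isCycle_of_le_degree (hc : IsProperEdgeColoring G c) (hG : G ≠ ⊥)
    {C d : ℝ} (hC : 0 < C) {k : ℕ} (hV : (Fintype.card V : ℝ) ≤ C ^ (k + 1))
    (hd : C * ((k + 1) * (2 * k + 1)) < d)
    (hdeg : ∀ v, G.degree v ≠ 0 → d ≤ G.degree v) :
    ∃ (v : V) (w : G.Walk v v), w.IsCycle ∧ (w.edges.map c).Nodup := by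
  by_contra hno
  have hd0 : 0 < d := lt_of_le_of_lt (by positivity) hd
  set N := ∑ b ∈ usedColors G c, colorMatrix G c b with hN
  have hR : ∀ v, rainbowSum (usedColors G c) (colorMatrix G c) (2 * (k + 1)) ∅ v v = 0 := by
    intro v
    by_contra hne
    obtain ⟨w, hlen, hnodup, -⟩ := exists_walk_of_rainbowSum_ne_zero _ hne
    exact hno (w.exists_rainbow_isCycle (by omega) hnodup)
  have hle : (N ^ (2 * (k + 1))).trace ≤
      (repeatSum (usedColors G c) (colorMatrix G c) (2 * (k + 1))).trace := by
    refine Finset.sum_le_sum fun v _ => ?_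
    have := powMajorant_sub_pow_apply_nonneg (S := usedColors G c) (W := colorMatrix G c)
      colorMatrix_apply_nonneg (2 * (k + 1)) (Finset.empty_subset _) v v
    simp only [powMajorant, Finset.sum_empty, add_zero, Matrix.sub_apply, Matrix.add_apply, hR v] at this
    simp only [diag_apply]
    linarith
  have hrep := trace_repeatSum_le (S := usedColors G c) (W := colorMatrix G c) (L := 2 * k)
    (K := d⁻¹ * (N ^ (2 * k)).trace)
    (fun a b hab => by
      have := sum_trace_colorMatrix_le hc hd0 hdeg (a := a) (b := b) (hab ▸ even_two_mul k)
      rwa [hab] at this) (2 * (k + 1)) 0 (by ring)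
  rw [pow_zero, one_mul] at hrep
  have hone : 1 ≤ (N ^ (2 * (k + 1))).trace := by
    refine isHermitian_sum_colorMatrix.one_le_trace_pow ?_ sum_colorMatrix_mulVec_sqrt_degree _
    obtain ⟨u, v, huv⟩ := SimpleGraph.ne_bot_iff_exists_adj.1 hG
    intro h0
    have : (0 : ℝ) < G.degree u := by
      exact_mod_cast (G.degree_pos_iff_exists_adj u).2 ⟨v, huv⟩
    exact (Real.sqrt_pos.2 this).ne' (congrFun h0 u)
  have hratio := isHermitian_sum_colorMatrix.trace_pow_le_mul_trace_pow hC hV hone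
  rw [← hN] at hratio
  set T := (N ^ (2 * (k + 1))).trace
  have hT : 0 < T := by linarith
  have : T ≤ (k + 1) * (2 * k + 1) * (d⁻¹ * (C * T)) := by
    refine (hle.trans hrep).trans ?_
    push_cast
    rw [show (2 * ((k : ℝ) + 1)) * (2 * ((k : ℝ) + 1) - 1) / 2 = (k + 1) * (2 * k + 1) by ring]
    gcongr
  have h2 : d * T ≤ C * ((k + 1) * (2 * k + 1)) * T := by
    calc d * T ≤ d * ((k + 1) * (2 * k + 1) * (d⁻¹ * (C * T))) := by gcongr
      _ = _ := by field_simp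
  exact absurd (le_of_mul_le_mul_right h2 hT) (not_le.2 hd)

open Classical in
/-- A graph with more than `d * |V|` edges has a nonempty subgraph without vertices of positive
degree less than `d`. -/
theorem SimpleGraph.exists_le_forall_le_degree (G : SimpleGraph V) {d : ℝ} (hd : 0 ≤ d)
    (hG : d * Fintype.card V < G.edgeSet.ncard) :
    ∃ H ≤ G, H ≠ ⊥ ∧ ∀ v, H.degree v ≠ 0 → d ≤ H.degree v := by
  let f : SimpleGraph V → ℝ := fun H => H.edgeSet.ncard - d * H.support.ncard
  have : Nonempty {H : SimpleGraph V // H ≤ G} := ⟨⟨G, le_rfl⟩⟩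
  obtain ⟨⟨H, hHG⟩, hmax⟩ :=
    Finite.exists_max (fun H : {H : SimpleGraph V // H ≤ G} => f H)
  have hpos : 0 < f H := by
    refine lt_of_lt_of_le ?_ (hmax ⟨G, le_rfl⟩)
    have h1 : (G.support.ncard : ℝ) ≤ Fintype.card V := by
      exact_mod_cast Nat.card_eq_fintype_card (α := V) ▸ Set.ncard_le_card G.support
    exact sub_pos.2 ((mul_le_mul_of_nonneg_left h1 hd).trans_lt hG)
  refine ⟨H, hHG, ?_, fun v hv => ?_⟩
  · rintro rfl
    have : (0 : ℝ) ≤ d * (⊥ : SimpleGraph V).support.ncard := by positivity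
    simp only [f, edgeSet_bot, Set.ncard_empty, Nat.cast_zero] at hpos
    linarith
  · have h := hmax ⟨H.deleteIncidenceSet v, (H.deleteIncidenceSet_le v).trans hHG⟩
    have hmem : v ∈ H.support := (H.degree_pos_iff_exists_adj v).1 (Nat.pos_of_ne_zero hv)
    have hsupp : (H.deleteIncidenceSet v).support.ncard + 1 ≤ H.support.ncard := by
      rw [← Set.ncard_sdiff_singleton_add_one hmem]
      exact Nat.add_le_add_right (Set.ncard_le_ncard (H.support_deleteIncidenceSet_subset v)) 1
    have hedge : H.edgeSet.ncard ≤ (H.deleteIncidenceSet v).edgeSet.ncard + H.degree v := by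
      have := H.card_edgeFinset_deleteIncidenceSet v
      rw [← coe_edgeFinset, ← coe_edgeFinset, Set.ncard_coe_finset, Set.ncard_coe_finset]
      omega
    have hsupp' : ((H.deleteIncidenceSet v).support.ncard : ℝ) + 1 ≤ H.support.ncard := by
      exact_mod_cast hsupp
    have hedge' : (H.edgeSet.ncard : ℝ) ≤
        (H.deleteIncidenceSet v).edgeSet.ncard + H.degree v := by exact_mod_cast hedge
    have hmul := mul_le_mul_of_nonneg_left hsupp' hd
    simp only [f] at h
    linarith

end Graphs

/-- If `n` is sufficiently large, any properly edge-coloured `n`-vertex graph with at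
least `8·n·(log n)²` edges contains a rainbow cycle (a cycle whose edges have pairwise
distinct colours). -/
theorem rainbow_cycle_of_many_edges :
    ∃ N : ℕ, ∀ n : ℕ, N ≤ n → ∀ (G : SimpleGraph (Fin n)) (β : Type) (c : Sym2 (Fin n) → β),
      IsProperEdgeColoring G c →
      8 * (n : ℝ) * Real.log n ^ 2 ≤ (G.edgeSet.ncard : ℝ) →
      ∃ (v : Fin n) (w : G.Walk v v), w.IsCycle ∧ (w.edges.map c).Nodup := by
  obtain ⟨N, hN⟩ := Filter.eventually_atTop.1
    ((Real.tendsto_log_atTop.comp tendsto_natCast_atTop_atTop).eventually_ge_atTop 10)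
  refine ⟨N + 1, fun n hn G β c hc hG => ?_⟩
  have hL : 10 ≤ Real.log n := hN n (by omega)
  have hn0 : (0 : ℝ) < n := by exact_mod_cast (by omega : 0 < n)
  set k := ⌊Real.log n⌋₊
  have hk : (k : ℝ) ≤ Real.log n := Nat.floor_le (by linarith)
  have hk' : Real.log n < k + 1 := Nat.lt_floor_add_one _
  have he : Real.exp 1 ≤ 2.72 := Real.exp_one_lt_d9.le.trans (by norm_num)
  set d : ℝ := 2.72 * ((Real.log n + 1) * (2 * Real.log n + 1)) + 1
  have hd : d < 8 * Real.log n ^ 2 := by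
    simp only [d]
    nlinarith
  have hd0 : 0 ≤ d := by positivity
  obtain ⟨H, hHG, hH, hdeg⟩ := G.exists_le_forall_le_degree hd0 (by
    rw [Fintype.card_fin]
    nlinarith)
  have hV : (Fintype.card (Fin n) : ℝ) ≤ Real.exp 1 ^ (k + 1) := by
    rw [Fintype.card_fin, ← Real.exp_nat_mul, mul_one, ← Real.log_le_iff_le_exp hn0]
    push_cast
    exact hk'.le
  have hkd : Real.exp 1 * ((k + 1) * (2 * k + 1)) < d := by
    have : Real.exp 1 * ((k + 1) * (2 * k + 1)) ≤
        2.72 * ((Real.log n + 1) * (2 * Real.log n + 1)) := by gcongr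
    exact this.trans_lt (lt_add_one _)
  obtain ⟨v, w, hw, hnodup⟩ :=
    exists_rainbow_isCycle_of_le_degree (hc.mono hHG) hH (Real.exp_pos 1) hV hkd hdeg
  exact ⟨v, w.mapLe hHG, hw.mapLe hHG, by rwa [Walk.edges_mapLe_eq_edges]⟩
end

section
/- Let H be a d-regular, reflective, connected bipartite graph which satisfies Sidorenko's conjecture and which is not isomorphic to the complete bipartite graph K_{d,d}. Then there exist ε = ε(H) > 0 and a constant C > 0 such that ex(n, H) ≤ C · n^{2 - 1/d - ε} for all n. -/
open SimpleGraph

/-- `hom(H, G)`: the number of graph homomorphisms from `H` to `G`. -/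
noncomputable def homCount {α β : Type} (H : SimpleGraph α) (G : SimpleGraph β) : ℕ :=
  Nat.card (H →g G)

/-- `hom(H, G; R)`: homomorphisms mapping all of `R` to one common vertex. -/
noncomputable def homCountOn {α β : Type} (H : SimpleGraph α) (G : SimpleGraph β)
    (R : Set α) : ℕ :=
  Nat.card {f : H →g G // ∃ v : β, ∀ u ∈ R, f u = v}

/-- The fixed-point set `F_φ` of a graph automorphism `φ`. -/
def FixedSet {V : Type} {H : SimpleGraph V} (φ : H ≃g H) : Set V := {v | φ v = v}

/-- `(A, B, φ)` is a nice triple of `H`: `φ` is an involutive automorphism; `A`, `B` and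
`F_φ` partition `V(H)`; `F_φ` separates `A` and `B` (every walk from `A` to `B` meets
`F_φ`); and `φ(A) = B`. -/
def IsNiceTriple {V : Type} (H : SimpleGraph V) (A B : Set V) (φ : H ≃g H) : Prop :=
  (∀ v, φ (φ v) = v) ∧
  Disjoint A B ∧ Disjoint A (FixedSet φ) ∧ Disjoint B (FixedSet φ) ∧
  A ∪ B ∪ FixedSet φ = Set.univ ∧
  (∀ a ∈ A, ∀ b ∈ B, ∀ w : H.Walk a b, ∃ v ∈ w.support, v ∈ FixedSet φ) ∧
  ⇑φ '' A = B

/-- `H` is bipartite with parts `X₁` and `X₂`. -/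
def IsBipartitionOf {V : Type} (H : SimpleGraph V) (X₁ X₂ : Set V) : Prop :=
  Disjoint X₁ X₂ ∧ X₁ ∪ X₂ = Set.univ ∧
  ∀ ⦃u v⦄, H.Adj u v → (u ∈ X₁ ∧ v ∈ X₂) ∨ (u ∈ X₂ ∧ v ∈ X₁)

/-- `R` is admissible for the nice triple `(A, B, φ)` (relative to the bipartition
`X₁, X₂` of `H`): all vertices of `R` lie in the same part, and `R` meets both
`A ∪ F_φ` and `B ∪ F_φ`. -/
def IsAdmissible {V : Type} {H : SimpleGraph V} (X₁ X₂ A B : Set V) (φ : H ≃g H)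
    (R : Set V) : Prop :=
  (R ⊆ X₁ ∨ R ⊆ X₂) ∧ (R ∩ (A ∪ FixedSet φ)).Nonempty ∧ (R ∩ (B ∪ FixedSet φ)).Nonempty

/-- `ψ_{A,B,φ}(R) = (R ∩ (A ∪ F_φ)) ∪ φ(R ∩ A)`. -/
def psiSet {V : Type} {H : SimpleGraph V} (A : Set V) (φ : H ≃g H) (R : Set V) : Set V :=
  (R ∩ (A ∪ FixedSet φ)) ∪ ⇑φ '' (R ∩ A)

/-- `H` (connected bipartite, with parts `X₁, X₂`) is reflective: every two-element
subset `R` of a part `X` can be transformed into `X` by a sequence of reflections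
`R_{j+1} = ψ_{A_j,B_j,φ_j}(R_j)` along nice triples for which `R_j` is admissible. -/
def IsReflective {V : Type} (H : SimpleGraph V) (X₁ X₂ : Set V) : Prop :=
  ∀ X : Set V, X = X₁ ∨ X = X₂ → ∀ R : Set V, R ⊆ X → R.ncard = 2 →
    ∃ (m : ℕ) (A B : ℕ → Set V) (φ : ℕ → (H ≃g H)) (Rs : ℕ → Set V),
      Rs 0 = R ∧ Rs m = X ∧
      ∀ j < m, IsNiceTriple H (A j) (B j) (φ j) ∧
        IsAdmissible X₁ X₂ (A j) (B j) (φ j) (Rs j) ∧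
        Rs (j + 1) = psiSet (A j) (φ j) (Rs j)

/-- `H` satisfies Sidorenko's conjecture: for every `n`-vertex graph `G` with edge
density `p`, `hom(H, G) ≥ n^(v(H)) · p^(e(H))`. -/
def SatisfiesSidorenko {V : Type} [Fintype V] (H : SimpleGraph V) : Prop :=
  ∀ (n : ℕ) (G : SimpleGraph (Fin n)) (p : ℝ),
    (G.edgeSet.ncard : ℝ) = p * (n : ℝ) ^ 2 / 2 →
    (n : ℝ) ^ (Fintype.card V) * p ^ (H.edgeSet.ncard) ≤ (homCount H G : ℝ)

/-- The degree of the vertex `v` in `G`. -/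
noncomputable def deg {V : Type} (G : SimpleGraph V) (v : V) : ℕ :=
  (G.neighborSet v).ncard

/-- `G` contains a subgraph isomorphic to `H`. -/
def ContainsCopy {α β : Type} (H : SimpleGraph α) (G : SimpleGraph β) : Prop :=
  ∃ f : H →g G, Function.Injective f

lemma card_filter_label_eq {α β κ : Type*} [DecidableEq κ] (K : Finset κ) (P : Finset α)
    (Q : Finset β) (kP : α → κ) (kQ : β → κ) (hPK : ∀ p ∈ P, kP p ∈ K) :
    ((P ×ˢ Q).filter fun p => kP p.1 = kQ p.2).card
      = ∑ k ∈ K, (P.filter fun p => kP p = k).card * (Q.filter fun q => kQ q = k).card := by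
  rw [Finset.card_eq_sum_card_fiberwise (f := fun p => kP p.1) (t := K)]
  · refine Finset.sum_congr rfl fun k _ => ?_
    rw [← Finset.card_product]
    congr 1
    ext ⟨p, q⟩
    simp only [Finset.mem_filter, Finset.mem_product]
    constructor
    · rintro ⟨⟨⟨hp, hq⟩, h⟩, h'⟩
      exact ⟨⟨hp, h'⟩, hq, h ▸ h'⟩
    · rintro ⟨⟨hp, h'⟩, hq, h⟩
      exact ⟨⟨⟨hp, hq⟩, h'.trans h.symm⟩, h'⟩
  · intro p hp
    simp only [Finset.coe_filter, Finset.mem_product] at hp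
    exact hPK _ hp.1.1

/-- A counting form of the Cauchy-Schwarz inequality: an injection `S → P × Q` compatible with
labels `kP`, `kQ`, together with injections of the label-preserving pairs into `S₁` and `S₂`. -/
lemma sq_card_le_of_common_label {α β γ δ κ : Type*} [DecidableEq κ]
    (S : Finset γ) (P : Finset α) (Q : Finset β)
    (kP : α → κ) (kQ : β → κ) (S₁ S₂ : Finset δ) (i : γ → α × β)
    (hi : ∀ f ∈ S, (i f).1 ∈ P ∧ (i f).2 ∈ Q ∧ kP (i f).1 = kQ (i f).2)
    (hinj : Set.InjOn i S)
    (h₁ : ((P ×ˢ P).filter fun p => kP p.1 = kP p.2).card ≤ S₁.card)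
    (h₂ : ((Q ×ˢ Q).filter fun p => kQ p.1 = kQ p.2).card ≤ S₂.card) :
    S.card ^ 2 ≤ S₁.card * S₂.card := by
  set K : Finset κ := P.image kP ∪ Q.image kQ
  have hPK : ∀ p ∈ P, kP p ∈ K := fun p hp =>
    Finset.mem_union_left _ (Finset.mem_image_of_mem _ hp)
  have hQK : ∀ q ∈ Q, kQ q ∈ K := fun q hq =>
    Finset.mem_union_right _ (Finset.mem_image_of_mem _ hq)
  have hS : S.card ≤ ((P ×ˢ Q).filter fun p => kP p.1 = kQ p.2).card := by
    refine Finset.card_le_card_of_injOn i (fun f hf => ?_) hinj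
    obtain ⟨h1, h2, h3⟩ := hi f hf
    simp [h1, h2, h3]
  have eP := card_filter_label_eq K P P kP kP hPK
  have eQ := card_filter_label_eq K Q Q kQ kQ hQK
  have ePQ := card_filter_label_eq K P Q kP kQ hPK
  calc S.card ^ 2 ≤ (((P ×ˢ Q).filter fun p => kP p.1 = kQ p.2).card) ^ 2 :=
        Nat.pow_le_pow_left hS 2
    _ ≤ ((P ×ˢ P).filter fun p => kP p.1 = kP p.2).card
        * ((Q ×ˢ Q).filter fun p => kQ p.1 = kQ p.2).card := by
        rw [eP, eQ, ePQ]
        simp only [← pow_two]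
        exact Finset.sum_mul_sq_le_sq_mul_sq _ _ _
    _ ≤ _ := Nat.mul_le_mul h₁ h₂

section Reflection

variable {V W : Type} {H : SimpleGraph V} {G : SimpleGraph W}

lemma IsNiceTriple.symm {A B : Set V} {φ : H ≃g H} (h : IsNiceTriple H A B φ) :
    IsNiceTriple H B A φ := by
  obtain ⟨h1, h2, h3, h4, h5, h6, h7⟩ := h
  refine ⟨h1, h2.symm, h4, h3, by rw [Set.union_comm B A, h5], fun b hb a ha w => ?_, ?_⟩
  · obtain ⟨v, hv, hv'⟩ := h6 a ha b hb w.reverse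
    exact ⟨v, by simpa using hv, hv'⟩
  · rw [← h7]
    ext x
    simp [h1]

lemma IsNiceTriple.apply_mem_right {A B : Set V} {φ : H ≃g H} (h : IsNiceTriple H A B φ)
    {x : V} (hx : x ∈ A) : φ x ∈ B := by
  rw [← h.2.2.2.2.2.2]
  exact ⟨x, hx, rfl⟩

lemma IsNiceTriple.apply_mem_left {A B : Set V} {φ : H ≃g H} (h : IsNiceTriple H A B φ)
    {x : V} (hx : x ∈ B) : φ x ∈ A := h.symm.apply_mem_right hx

lemma IsNiceTriple.not_adj {A B : Set V} {φ : H ≃g H} (h : IsNiceTriple H A B φ)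
    {a b : V} (ha : a ∈ A) (hb : b ∈ B) : ¬ H.Adj a b := by
  intro hab
  obtain ⟨v, hv, hv'⟩ := h.2.2.2.2.2.1 a ha b hb hab.toWalk
  have : v = a ∨ v = b := by simpa using hv
  rcases this with rfl | rfl
  · exact Set.disjoint_left.mp h.2.2.1 ha hv'
  · exact Set.disjoint_left.mp h.2.2.2.1 hb hv'

lemma IsNiceTriple.mem_cases {A B : Set V} {φ : H ≃g H} (h : IsNiceTriple H A B φ) (v : V) :
    (v ∈ A ∧ v ∉ B ∧ v ∉ FixedSet φ) ∨ (v ∈ B ∧ v ∉ A ∧ v ∉ FixedSet φ) ∨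
      (v ∈ FixedSet φ ∧ v ∉ A ∧ v ∉ B) := by
  have h5 : v ∈ A ∪ B ∪ FixedSet φ := by rw [h.2.2.2.2.1]; trivial
  have h2 : v ∈ A → v ∉ B := fun hv => Set.disjoint_left.mp h.2.1 hv
  have h3 : v ∈ A → v ∉ FixedSet φ := fun hv => Set.disjoint_left.mp h.2.2.1 hv
  have h4 : v ∈ B → v ∉ FixedSet φ := fun hv => Set.disjoint_left.mp h.2.2.2.1 hv
  rcases h5 with (h5 | h5) | h5 <;> tauto

open scoped Classical in
/-- The retraction that folds `B` onto the other side of a reflection `φ`. -/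
noncomputable def foldMap (B : Set V) (φ : H ≃g H) (v : V) : V := if v ∈ B then φ v else v

lemma IsNiceTriple.foldMap_adj {A B : Set V} {φ : H ≃g H} (h : IsNiceTriple H A B φ)
    {u v : V} (huv : H.Adj u v) : H.Adj (foldMap B φ u) (foldMap B φ v) := by
  have hφ : H.Adj (φ u) (φ v) := φ.map_adj_iff.mpr huv
  unfold foldMap
  split_ifs with hu hv hv
  · exact hφ
  · rcases h.mem_cases v with hv' | hv' | hv'
    · exact absurd huv.symm (h.not_adj hv'.1 hu)
    · exact absurd hv'.1 hv
    · have : φ v = v := hv'.1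
      rwa [this] at hφ
  · rcases h.mem_cases u with hu' | hu' | hu'
    · exact absurd huv (h.not_adj hu'.1 hv)
    · exact absurd hu'.1 hu
    · have : φ u = u := hu'.1
      rwa [this] at hφ
  · exact huv

/-- The restriction of `f` to the fixed set of `φ`, together with the value at `r`. -/
def fixedLabel (φ : H ≃g H) (r : V) (f : V → W) : (FixedSet φ → W) × W := (fun v => f v, f r)

lemma fixedLabel_eq_iff {φ : H ≃g H} {r r' : V} {f f' : V → W} :
    fixedLabel φ r f = fixedLabel φ r' f' ↔ (∀ v ∈ FixedSet φ, f v = f' v) ∧ f r = f' r' := by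
  simp [fixedLabel, funext_iff]

variable [Fintype V] [Fintype W]

open scoped Classical in
/-- The homomorphisms from `H` to `G`, as functions, that are constant on `R`. -/
noncomputable def homsConstOn {V W : Type} [Fintype V] [Fintype W] (H : SimpleGraph V)
    (G : SimpleGraph W) (R : Set V) : Finset (V → W) :=
  {f | (∀ u v, H.Adj u v → G.Adj (f u) (f v)) ∧ ∀ u ∈ R, ∀ v ∈ R, f u = f v}

lemma mem_homsConstOn {R : Set V} {f : V → W} :
    f ∈ homsConstOn H G R ↔
      (∀ u v, H.Adj u v → G.Adj (f u) (f v)) ∧ ∀ u ∈ R, ∀ v ∈ R, f u = f v := by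
  simp [homsConstOn]

lemma homsConstOn_anti {R S : Set V} (h : R ⊆ S) : homsConstOn H G S ⊆ homsConstOn H G R := by
  intro f hf
  rw [mem_homsConstOn] at hf ⊢
  exact ⟨hf.1, fun u hu v hv => hf.2 u (h hu) v (h hv)⟩

open scoped Classical in
/-- Homomorphisms invariant under folding `B`, constant on the rest of `R`. -/
noncomputable def foldedHoms (G : SimpleGraph W) (A B : Set V) (φ : H ≃g H) (R : Set V) :
    Finset (V → W) :=
  (homsConstOn H G (R ∩ (A ∪ FixedSet φ))).filter fun g => ∀ v ∈ B, g v = g (φ v)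

open scoped Classical in
lemma card_foldedHoms_pairs_le {A B : Set V} {φ : H ≃g H} (h : IsNiceTriple H A B φ) {R : Set V}
    {r : V} (hr : r ∈ R ∩ (A ∪ FixedSet φ)) :
    ((foldedHoms G A B φ R ×ˢ foldedHoms G A B φ R).filter
      fun p => fixedLabel φ r p.1 = fixedLabel φ r p.2).card
      ≤ (homsConstOn H G (psiSet A φ R)).card := by
  have hφ : ∀ v, φ (φ v) = v := h.1
  refine Finset.card_le_card_of_injOn (fun p v => if v ∈ B then p.2 v else p.1 v) ?_ ?_
  · rintro ⟨p, p'⟩ hp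
    simp only [Finset.coe_filter, Finset.mem_product, foldedHoms, Finset.mem_filter,
      mem_homsConstOn, fixedLabel_eq_iff, Set.mem_ofPred_eq] at hp
    obtain ⟨⟨⟨⟨p1, p2⟩, p3⟩, ⟨q1, q2⟩, q3⟩, hF, hreq⟩ := hp
    simp only [Finset.mem_coe, mem_homsConstOn]
    refine ⟨fun u v huv => ?_, ?_⟩
    · split_ifs with hu hv hv
      · exact q1 u v huv
      · rcases h.mem_cases v with hv' | hv' | hv'
        · exact absurd huv.symm (h.not_adj hv'.1 hu)
        · exact absurd hv'.1 hv
        · rw [hF v hv'.1]; exact q1 u v huv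
      · rcases h.mem_cases u with hu' | hu' | hu'
        · exact absurd huv (h.not_adj hu'.1 hv)
        · exact absurd hu'.1 hu
        · rw [hF u hu'.1]; exact q1 u v huv
      · exact p1 u v huv
    · suffices H : ∀ u ∈ psiSet A φ R, (if u ∈ B then p' u else p u) = p r from
        fun u hu v hv => (H u hu).trans (H v hv).symm
      rintro u (hu | ⟨x, ⟨hx, hxA⟩, rfl⟩)
      · have : u ∉ B := by
          rcases h.mem_cases u with h' | h' | h'
          · exact h'.2.1
          · rcases hu.2 with h'' | h'' <;> tauto
          · exact h'.2.2
        rw [if_neg this]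
        exact p2 _ hu _ hr
      · have hB := h.apply_mem_right hxA
        rw [if_pos hB, q3 _ hB, hφ, hreq]
        exact q2 _ ⟨hx, Or.inl hxA⟩ _ hr
  · rintro ⟨p, p'⟩ hp ⟨q, q'⟩ hq heq
    simp only [Finset.coe_filter, Finset.mem_product, foldedHoms, Finset.mem_filter,
      mem_homsConstOn, fixedLabel_eq_iff, Set.mem_ofPred_eq] at hp hq
    obtain ⟨⟨⟨-, p3⟩, -, p3'⟩, hF, -⟩ := hp
    obtain ⟨⟨⟨-, q3⟩, -, q3'⟩, hF', -⟩ := hq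
    have e : ∀ v, (if v ∈ B then p' v else p v) = if v ∈ B then q' v else q v := congrFun heq
    have e1 : ∀ v, v ∉ B → p v = q v := fun v hv => by simpa [hv] using e v
    have e2 : ∀ v, v ∈ B → p' v = q' v := fun v hv => by simpa [hv] using e v
    have hAB : ∀ v ∈ A, v ∉ B := fun v hv => Set.disjoint_left.mp h.2.1 hv
    refine Prod.ext (funext fun v => ?_) (funext fun v => ?_)
    · by_cases hv : v ∈ B
      · simp only
        rw [p3 v hv, q3 v hv, e1 _ (hAB _ (h.apply_mem_left hv))]
      · exact e1 v hv
    · rcases h.mem_cases v with hv | hv | hv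
      · have hB := h.apply_mem_right hv.1
        have a1 := p3' _ hB
        have a2 := q3' _ hB
        rw [hφ] at a1 a2
        simp only
        rw [← a1, ← a2, e2 _ hB]
      · exact e2 v hv.1
      · simp only
        rw [← hF v hv.1, ← hF' v hv.1, e1 v hv.2.2]

lemma IsNiceTriple.comp_foldMap_mem {A B : Set V} {φ : H ≃g H} (h : IsNiceTriple H A B φ)
    {R : Set V} {f : V → W} (hf : f ∈ homsConstOn H G R) :
    f ∘ foldMap B φ ∈ foldedHoms G A B φ R := by
  rw [mem_homsConstOn] at hf
  have hid : ∀ v ∈ A ∪ FixedSet φ, foldMap B φ v = v := by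
    intro v hv
    have : v ∉ B := by
      rcases h.mem_cases v with h' | h' | h'
      · exact h'.2.1
      · rcases hv with h'' | h'' <;> tauto
      · exact h'.2.2
    simp [foldMap, this]
  simp only [foldedHoms, Finset.mem_filter, mem_homsConstOn, Function.comp]
  refine ⟨⟨fun u v huv => hf.1 _ _ (h.foldMap_adj huv), fun u hu v hv => ?_⟩, fun v hv => ?_⟩
  · rw [hid u hu.2, hid v hv.2]
    exact hf.2 u hu.1 v hv.1
  · rw [hid (φ v) (Or.inl (h.apply_mem_left hv))]
    simp [foldMap, hv]

lemma sq_card_homsConstOn_le {A B : Set V} {φ : H ≃g H} (h : IsNiceTriple H A B φ) {R : Set V}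
    (hA : (R ∩ (A ∪ FixedSet φ)).Nonempty) (hB : (R ∩ (B ∪ FixedSet φ)).Nonempty) :
    (homsConstOn H G R).card ^ 2
      ≤ (homsConstOn H G (psiSet A φ R)).card * (homsConstOn H G (psiSet B φ R)).card := by
  classical
  obtain ⟨a, ha⟩ := hA
  obtain ⟨b, hb⟩ := hB
  have hAB : ∀ v ∈ A, v ∉ B := fun v hv => Set.disjoint_left.mp h.2.1 hv
  have hBA : ∀ v ∈ B, v ∉ A := fun v hv => Set.disjoint_right.mp h.2.1 hv
  have hFA : ∀ v ∈ FixedSet φ, v ∉ A := fun v hv => Set.disjoint_right.mp h.2.2.1 hv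
  have hFB : ∀ v ∈ FixedSet φ, v ∉ B := fun v hv => Set.disjoint_right.mp h.2.2.2.1 hv
  refine sq_card_le_of_common_label _ (foldedHoms G A B φ R) (foldedHoms G B A φ R)
    (fixedLabel φ a) (fixedLabel φ b) _ _ (fun f => (f ∘ foldMap B φ, f ∘ foldMap A φ)) ?_ ?_
    (card_foldedHoms_pairs_le h ha) (card_foldedHoms_pairs_le h.symm hb)
  · intro f hf
    refine ⟨h.comp_foldMap_mem hf, h.symm.comp_foldMap_mem hf, ?_⟩
    rw [mem_homsConstOn] at hf
    rw [fixedLabel_eq_iff]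
    refine ⟨fun v hv => by simp [foldMap, hFA v hv, hFB v hv], ?_⟩
    have haB : a ∉ B := by rcases ha.2 with h' | h' <;> [exact hAB a h'; exact hFB a h']
    have hbA : b ∉ A := by rcases hb.2 with h' | h' <;> [exact hBA b h'; exact hFA b h']
    simpa [foldMap, haB, hbA] using hf.2 a ha.1 b hb.1
  · intro f _ f' _ heq
    simp only [Prod.mk.injEq] at heq
    funext v
    by_cases hv : v ∈ B
    · simpa [foldMap, hBA v hv] using congrFun heq.2 v
    · simpa [foldMap, hv] using congrFun heq.1 v

end Reflection

section NonInjective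

variable {V W : Type} {H : SimpleGraph V} {G : SimpleGraph W}

/-- A homomorphism from a connected bipartite graph to a bipartite graph respects the parts. -/
lemma color_eq_iff_of_hom {X₁ X₂ : Set V} (hbip : IsBipartitionOf H X₁ X₂) (hconn : H.Connected)
    {c : W → Bool} (hc : ∀ u v, G.Adj u v → c u ≠ c v) {f : V → W}
    (hf : ∀ u v, H.Adj u v → G.Adj (f u) (f v)) (x y : V) :
    c (f x) = c (f y) ↔ (x ∈ X₁ ↔ y ∈ X₁) := by
  obtain ⟨w⟩ := hconn.preconnected x y
  induction w with
  | nil => simp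
  | @cons u v w huv p ih =>
    have h1 := hc _ _ (hf _ _ huv)
    have h2 : u ∈ X₁ ↔ v ∉ X₁ := by
      have hd1 : ∀ z ∈ X₁, z ∉ X₂ := fun z hz => Set.disjoint_left.mp hbip.1 hz
      rcases hbip.2.2 huv with h | h
      · have := fun hv => hd1 v hv h.2
        tauto
      · have := fun hu => hd1 u hu h.1
        tauto
    revert h1 ih
    cases c (f u) <;> cases c (f v) <;> cases c (f w) <;> simp <;> tauto

variable [Fintype V] [Fintype W]

lemma pow_card_homsConstOn_le_of_chain {X₁ X₂ : Set V} (A B : ℕ → Set V) (φ : ℕ → (H ≃g H))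
    (Rs : ℕ → Set V) (m : ℕ)
    (h : ∀ j < m, IsNiceTriple H (A j) (B j) (φ j) ∧
      IsAdmissible X₁ X₂ (A j) (B j) (φ j) (Rs j) ∧ Rs (j + 1) = psiSet (A j) (φ j) (Rs j)) :
    (homsConstOn H G (Rs 0)).card ^ 2 ^ m
      ≤ (homsConstOn H G (Rs m)).card * (homsConstOn H G ∅).card ^ (2 ^ m - 1) := by
  induction m with
  | zero => simp
  | succ m ih =>
    obtain ⟨h1, h2, h3⟩ := h m (Nat.lt_succ_self m)
    have ih := ih fun j hj => h j (hj.trans (Nat.lt_succ_self m))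
    have cs := sq_card_homsConstOn_le (G := G) h1 h2.2.1 h2.2.2
    rw [← h3] at cs
    have hle := Finset.card_le_card
      (homsConstOn_anti (H := H) (G := G) (Set.empty_subset (psiSet (B m) (φ m) (Rs m))))
    have he : 2 ^ (m + 1) - 1 = 1 + (2 ^ m - 1) * 2 := by
      have := Nat.one_le_two_pow (n := m)
      rw [pow_succ]; omega
    calc (homsConstOn H G (Rs 0)).card ^ 2 ^ (m + 1)
        = ((homsConstOn H G (Rs 0)).card ^ 2 ^ m) ^ 2 := by rw [pow_succ, pow_mul]
      _ ≤ ((homsConstOn H G (Rs m)).card * (homsConstOn H G ∅).card ^ (2 ^ m - 1)) ^ 2 :=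
          Nat.pow_le_pow_left ih 2
      _ = (homsConstOn H G (Rs m)).card ^ 2 * (homsConstOn H G ∅).card ^ ((2 ^ m - 1) * 2) := by
          rw [mul_pow, pow_mul]
      _ ≤ ((homsConstOn H G (Rs (m + 1))).card * (homsConstOn H G ∅).card)
          * (homsConstOn H G ∅).card ^ ((2 ^ m - 1) * 2) :=
          Nat.mul_le_mul_right _ (cs.trans (Nat.mul_le_mul_left _ hle))
      _ = _ := by rw [he, pow_add, pow_one, mul_assoc]

lemma card_homsConstOn_empty_le_of_pair (hG : ¬ ContainsCopy H G) {X₁ X₂ : Set V}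
    (hbip : IsBipartitionOf H X₁ X₂) (hconn : H.Connected)
    {c : W → Bool} (hc : ∀ u v, G.Adj u v → c u ≠ c v) (hne : (homsConstOn H G ∅).Nonempty) :
    ∃ x y : V, x ≠ y ∧ (x ∈ X₁ ↔ y ∈ X₁) ∧
      (homsConstOn H G ∅).card ≤ Fintype.card V ^ 2 * (homsConstOn H G {x, y}).card := by
  classical
  set P : Finset (V × V) :=
    Finset.univ.filter fun p => p.1 ≠ p.2 ∧ (p.1 ∈ X₁ ↔ p.2 ∈ X₁) with hP
  have hsub : homsConstOn H G ∅ ⊆ P.biUnion fun p => homsConstOn H G {p.1, p.2} := by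
    intro f hf
    have hf' := (mem_homsConstOn.mp hf).1
    have hninj : ¬ Function.Injective f := fun hinj =>
      hG ⟨⟨f, fun {u v} huv => hf' u v huv⟩, hinj⟩
    simp only [Function.Injective, not_forall] at hninj
    obtain ⟨x, y, hxy, hne⟩ := hninj
    refine Finset.mem_biUnion.mpr ⟨(x, y), ?_, ?_⟩
    · simp only [hP, Finset.mem_filter, Finset.mem_univ, true_and]
      exact ⟨hne, (color_eq_iff_of_hom hbip hconn hc hf' x y).mp (by rw [hxy])⟩
    · rw [mem_homsConstOn]
      refine ⟨hf', ?_⟩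
      rintro u (rfl | rfl) v (rfl | rfl) <;> simp [hxy]
  have hPne : P.Nonempty := by
    obtain ⟨f, hf⟩ := hne
    obtain ⟨p, hp, -⟩ := Finset.mem_biUnion.mp (hsub hf)
    exact ⟨p, hp⟩
  obtain ⟨p, hp, hmax⟩ := P.exists_max_image (fun p => (homsConstOn H G {p.1, p.2}).card) hPne
  simp only [hP, Finset.mem_filter, Finset.mem_univ, true_and] at hp
  refine ⟨p.1, p.2, hp.1, hp.2, ?_⟩
  calc (homsConstOn H G ∅).card ≤ (P.biUnion fun p => homsConstOn H G {p.1, p.2}).card :=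
        Finset.card_le_card hsub
    _ ≤ P.card * (homsConstOn H G {p.1, p.2}).card := Finset.card_biUnion_le_card_mul _ _ _ hmax
    _ ≤ _ := by
        refine Nat.mul_le_mul_right _ ((Finset.card_le_univ P).trans ?_)
        simp [pow_two]

lemma exists_card_homsConstOn_empty_le {X₁ X₂ : Set V} (hbip : IsBipartitionOf H X₁ X₂)
    (hconn : H.Connected) (hrefl : IsReflective H X₁ X₂) :
    ∃ C : ℕ, ∀ (W : Type) [Fintype W] (G : SimpleGraph W) (c : W → Bool),
      (∀ u v, G.Adj u v → c u ≠ c v) → ¬ ContainsCopy H G →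
      (homsConstOn H G ∅).card
        ≤ C * ((homsConstOn H G X₁).card + (homsConstOn H G X₂).card) := by
  classical
  have hchain : ∀ x y : V, ∃ m : ℕ, x ≠ y → (x ∈ X₁ ↔ y ∈ X₁) →
      ∀ (W : Type) [Fintype W] (G : SimpleGraph W),
      (homsConstOn H G {x, y}).card ^ 2 ^ m
        ≤ ((homsConstOn H G X₁).card + (homsConstOn H G X₂).card)
          * (homsConstOn H G ∅).card ^ (2 ^ m - 1) := by
    intro x y
    by_cases hxy : x ≠ y ∧ (x ∈ X₁ ↔ y ∈ X₁)
    swap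
    · exact ⟨0, fun h1 h2 => absurd ⟨h1, h2⟩ hxy⟩
    have hX : ∃ X : Set V, (X = X₁ ∨ X = X₂) ∧ x ∈ X ∧ y ∈ X := by
      have hu : ∀ z, z ∈ X₁ ∨ z ∈ X₂ := fun z => by
        have : z ∈ X₁ ∪ X₂ := by rw [hbip.2.1]; trivial
        exact this
      by_cases hx : x ∈ X₁
      · exact ⟨X₁, Or.inl rfl, hx, hxy.2.mp hx⟩
      · exact ⟨X₂, Or.inr rfl, (hu x).resolve_left hx,
          (hu y).resolve_left (mt hxy.2.mpr hx)⟩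
    obtain ⟨X, hX, hxX, hyX⟩ := hX
    obtain ⟨m, A, B, φ, Rs, h0, hm, hj⟩ := hrefl X hX {x, y}
      (by rintro z (rfl | rfl) <;> assumption) (Set.ncard_pair hxy.1)
    refine ⟨m, fun _ _ W _ G => ?_⟩
    have := pow_card_homsConstOn_le_of_chain (G := G) A B φ Rs m hj
    rw [h0, hm] at this
    refine this.trans (Nat.mul_le_mul_right _ ?_)
    rcases hX with rfl | rfl <;> omega
  choose m hm using hchain
  obtain ⟨M, hM⟩ : ∃ M, ∀ x y, m x y ≤ M :=
    ⟨Finset.univ.sup fun p : V × V => m p.1 p.2, fun x y =>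
      Finset.le_sup (f := fun p : V × V => m p.1 p.2) (Finset.mem_univ (x, y))⟩
  refine ⟨(Fintype.card V ^ 2) ^ 2 ^ M, fun W _ G c hc hG => ?_⟩
  rcases (homsConstOn H G ∅).eq_empty_or_nonempty with he | hne
  · simp [he]
  obtain ⟨x, y, hxy, hX, hle⟩ := card_homsConstOn_empty_le_of_pair hG hbip hconn hc hne
  have hmm := hm x y hxy hX W G
  have hpos := hne.card_pos
  set N := (homsConstOn H G ∅).card
  set S := (homsConstOn H G X₁).card + (homsConstOn H G X₂).card
  have hV : 1 ≤ Fintype.card V := Fintype.card_pos_iff.mpr ⟨x⟩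
  have h2 : N * N ^ (2 ^ m x y - 1) ≤ (Fintype.card V ^ 2) ^ 2 ^ M * S * N ^ (2 ^ m x y - 1) := by
    calc N * N ^ (2 ^ m x y - 1) = N ^ 2 ^ m x y := by
          rw [← pow_succ', Nat.sub_add_cancel Nat.one_le_two_pow]
      _ ≤ (Fintype.card V ^ 2 * (homsConstOn H G {x, y}).card) ^ 2 ^ m x y :=
          Nat.pow_le_pow_left hle _
      _ ≤ (Fintype.card V ^ 2) ^ 2 ^ M * (S * N ^ (2 ^ m x y - 1)) := by
          rw [mul_pow]
          exact Nat.mul_le_mul (Nat.pow_le_pow_right (Nat.one_le_pow _ _ hV)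
            (Nat.pow_le_pow_right two_pos (hM x y))) hmm
      _ = _ := by rw [mul_assoc]
  exact Nat.le_of_mul_le_mul_right h2 (pow_pos hpos _)

end NonInjective

section Counting

variable {V W : Type} [Fintype V] [Fintype W] {H : SimpleGraph V} {G : SimpleGraph W}

lemma card_homsConstOn_le_sum_degree_pow {X : Set V} (hne : X.Nonempty)
    (hX : ∀ y ∉ X, ∃ x ∈ X, H.Adj x y) :
    (homsConstOn H G X).card ≤ ∑ w, (G.neighborSet w).ncard ^ Xᶜ.ncard := by
  classical
  obtain ⟨x₀, hx₀⟩ := hne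
  have hsub : homsConstOn H G X ⊆ Finset.univ.biUnion fun w : W =>
      Fintype.piFinset fun x => if x ∈ X then {w} else (G.neighborSet w).toFinset := by
    intro f hf
    rw [mem_homsConstOn] at hf
    simp only [Finset.mem_biUnion, Finset.mem_univ, true_and, Fintype.mem_piFinset]
    refine ⟨f x₀, fun y => ?_⟩
    split_ifs with hy
    · simpa using hf.2 y hy x₀ hx₀
    · obtain ⟨x, hx, hxy⟩ := hX y hy
      simpa [← hf.2 x hx x₀ hx₀] using hf.1 x y hxy
  refine (Finset.card_le_card hsub).trans (Finset.card_biUnion_le.trans ?_)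
  refine Finset.sum_le_sum fun w _ => ?_
  rw [Fintype.card_piFinset]
  have : ∀ x, (if x ∈ X then {w} else (G.neighborSet w).toFinset : Finset W).card
      = if x ∈ Xᶜ then (G.neighborSet w).ncard else 1 := by
    intro x
    by_cases hx : x ∈ X <;> simp [hx, Set.ncard_eq_toFinset_card']
  simp only [this]
  rw [Finset.prod_ite, Finset.prod_const, Finset.prod_const_one, mul_one,
    Set.ncard_eq_toFinset_card' Xᶜ]
  exact le_of_eq (by congr 2; ext; simp)

lemma homCount_eq_card_homsConstOn : homCount H G = (homsConstOn H G ∅).card := by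
  rw [homCount, ← Fintype.card_coe, ← Nat.card_eq_fintype_card]
  exact Nat.card_congr
    ⟨fun f => ⟨f, mem_homsConstOn.mpr ⟨fun _ _ h => f.map_adj h, by simp⟩⟩,
      fun f => ⟨f, fun {u v} h => (mem_homsConstOn.mp f.2).1 u v h⟩,
      fun _ => rfl, fun _ => rfl⟩

lemma SatisfiesSidorenko.le_card_homsConstOn (hsid : SatisfiesSidorenko H) (hW : 0 < Fintype.card W)
    (G : SimpleGraph W) :
    (Fintype.card W : ℝ) ^ Fintype.card V
        * (2 * G.edgeSet.ncard / (Fintype.card W : ℝ) ^ 2) ^ H.edgeSet.ncard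
      ≤ (homsConstOn H G ∅).card := by
  have i := G.overFinIso rfl
  have he : (G.overFin rfl).edgeSet.ncard = G.edgeSet.ncard :=
    (Nat.card_congr i.mapEdgeSet).symm
  have hh : homCount H (G.overFin rfl) = homCount H G :=
    Nat.card_congr ⟨fun f => i.symm.toHom.comp f, fun f => i.toHom.comp f,
      fun f => by ext x; simp, fun f => by ext x; simp⟩
  have := hsid _ (G.overFin rfl) (2 * G.edgeSet.ncard / (Fintype.card W : ℝ) ^ 2) (by
    rw [he]
    have : (Fintype.card W : ℝ) ≠ 0 := by exact_mod_cast hW.ne'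
    field_simp)
  rwa [hh, homCount_eq_card_homsConstOn] at this

end Counting

section BipartiteGraph

variable {α β : Type}

/-- The bipartite graph on `α ⊕ β` given by a relation. -/
def bipGraph (E : α → β → Prop) : SimpleGraph (α ⊕ β) where
  Adj x y := (∃ u v, E u v ∧ x = Sum.inl u ∧ y = Sum.inr v) ∨
    ∃ u v, E u v ∧ y = Sum.inl u ∧ x = Sum.inr v
  symm := ⟨fun _ _ h => h.symm⟩
  loopless := ⟨fun x h => by rcases h with ⟨u, v, -, rfl, h⟩ | ⟨u, v, -, rfl, h⟩ <;> cases h⟩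

@[simp] lemma bipGraph_adj_inl_inr {E : α → β → Prop} {u : α} {v : β} :
    (bipGraph E).Adj (Sum.inl u) (Sum.inr v) ↔ E u v := by simp [bipGraph]

@[simp] lemma bipGraph_adj_inr_inl {E : α → β → Prop} {u : α} {v : β} :
    (bipGraph E).Adj (Sum.inr v) (Sum.inl u) ↔ E u v := by simp [bipGraph]

@[simp] lemma bipGraph_not_adj_inl_inl {E : α → β → Prop} {u v : α} :
    ¬ (bipGraph E).Adj (Sum.inl u) (Sum.inl v) := by simp [bipGraph]

@[simp] lemma bipGraph_not_adj_inr_inr {E : α → β → Prop} {u v : β} :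
    ¬ (bipGraph E).Adj (Sum.inr u) (Sum.inr v) := by simp [bipGraph]

lemma bipGraph_isLeft_ne {E : α → β → Prop} (x y : α ⊕ β) (h : (bipGraph E).Adj x y) :
    x.isLeft ≠ y.isLeft := by
  rcases x with x | x <;> rcases y with y | y <;> simp_all

lemma ncard_edgeSet_bipGraph (E : α → β → Prop) :
    (bipGraph E).edgeSet.ncard = {p : α × β | E p.1 p.2}.ncard := by
  have : (bipGraph E).edgeSet
      = (fun p : α × β => s(Sum.inl p.1, Sum.inr p.2)) '' {p : α × β | E p.1 p.2} := by
    ext e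
    induction e with
    | _ x y => rcases x with x | x <;> rcases y with y | y <;> simp [SimpleGraph.mem_edgeSet]
  rw [this, Set.ncard_image_of_injective]
  rintro ⟨a, b⟩ ⟨a', b'⟩ h
  simpa using h

lemma neighborSet_bipGraph_inl (E : α → β → Prop) (u : α) :
    (bipGraph E).neighborSet (Sum.inl u) = Sum.inr '' {v | E u v} := by
  ext x
  rcases x with x | x <;> simp

lemma neighborSet_bipGraph_inr (E : α → β → Prop) (v : β) :
    (bipGraph E).neighborSet (Sum.inr v) = Sum.inl '' {u | E u v} := by
  ext x
  rcases x with x | x <;> simp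

lemma sum_degree_pow_bipGraph_le [Fintype α] [Fintype β] (E : α → β → Prop) (t D D' : ℕ)
    (hD : ∀ u, {v | E u v}.ncard ≤ D) (hD' : ∀ v, {u | E u v}.ncard ≤ D') :
    ∑ w, ((bipGraph E).neighborSet w).ncard ^ t
      ≤ Fintype.card α * D ^ t + Fintype.card β * D' ^ t := by
  rw [Fintype.sum_sum_type]
  refine Nat.add_le_add ?_ ?_
  · refine (Finset.sum_le_card_nsmul _ _ (D ^ t) fun u _ => ?_).trans (by simp)
    rw [neighborSet_bipGraph_inl, Set.ncard_image_of_injective _ Sum.inr_injective]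
    exact Nat.pow_le_pow_left (hD u) t
  · refine (Finset.sum_le_card_nsmul _ _ (D' ^ t) fun u _ => ?_).trans (by simp)
    rw [neighborSet_bipGraph_inr, Set.ncard_image_of_injective _ Sum.inl_injective]
    exact Nat.pow_le_pow_left (hD' u) t

/-- Blowing up both sides of a bipartite graph so that they have equal sizes. -/
def balancedBlowup (E : α → β → Prop) : α × β → α × β → Prop := fun p q => E p.1 q.2

lemma ncard_balancedBlowup [Fintype α] [Fintype β] (E : α → β → Prop) :
    {p : (α × β) × (α × β) | balancedBlowup E p.1 p.2}.ncard
      = {p : α × β | E p.1 p.2}.ncard * (Fintype.card α * Fintype.card β) := by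
  have h : {p : (α × β) × (α × β) | balancedBlowup E p.1 p.2}
      = (fun q : (α × β) × (α × β) => ((q.1.1, q.2.2), (q.2.1, q.1.2)))
        '' ({p : α × β | E p.1 p.2} ×ˢ Set.univ) := by
    ext ⟨⟨a, b⟩, ⟨a', b'⟩⟩
    simp [balancedBlowup]
  rw [h, Set.ncard_image_of_injective, Set.ncard_prod, Set.ncard_univ]
  · simp
  · rintro ⟨⟨a, b⟩, ⟨a', b'⟩⟩ ⟨⟨c, d⟩, ⟨c', d'⟩⟩ h
    simp at h ⊢
    tauto

variable {V : Type} [Fintype V] {H : SimpleGraph V}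

lemma card_homs_balancedBlowup_le [Fintype α] [Fintype β] (E : α → β → Prop) {X₁ X₂ : Set V}
    (hbip : IsBipartitionOf H X₁ X₂) (hconn : H.Connected) {t : ℕ} (h₁ : X₁.ncard = t)
    (h₂ : X₂.ncard = t) :
    (homsConstOn H (bipGraph (balancedBlowup E)) ∅).card
      ≤ (Fintype.card α * Fintype.card β) ^ t * (homsConstOn H (bipGraph E) ∅).card := by
  classical
  have hcompl : X₂ = X₁ᶜ := by
    exact (IsCompl.compl_eq ⟨hbip.1, codisjoint_iff.mpr hbip.2.1⟩).symm
  set π : (α × β) ⊕ (α × β) → α ⊕ β := Sum.map Prod.fst Prod.snd with hπ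
  refine Finset.card_le_mul_card_image_of_maps_to (f := fun f => π ∘ f) ?_ _ ?_
  · intro f hf
    rw [mem_homsConstOn] at hf ⊢
    refine ⟨fun u v huv => ?_, by simp⟩
    have := hf.1 u v huv
    revert this
    simp only [Function.comp, hπ]
    rcases f u with x | x <;> rcases f v with y | y <;> simp [balancedBlowup]
  · intro g hg
    have hg' := (mem_homsConstOn.mp hg).1
    have hsub : ((homsConstOn H (bipGraph (balancedBlowup E)) ∅).filter fun f => π ∘ f = g)
        ⊆ Fintype.piFinset fun x => Finset.univ.filter fun w => π w = g x := by
      intro f hf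
      simp only [Finset.mem_filter] at hf
      simp [Fintype.mem_piFinset, ← hf.2]
    refine (Finset.card_le_card hsub).trans ?_
    rw [Fintype.card_piFinset]
    have hfib : ∀ x, (Finset.univ.filter fun w => π w = g x).card
        = if (g x).isLeft then Fintype.card β else Fintype.card α := by
      intro x
      rcases g x with u | v
      · have : (Finset.univ.filter fun w => π w = Sum.inl u)
            = Finset.univ.image fun v : β => (Sum.inl (u, v) : (α × β) ⊕ (α × β)) := by
          ext w
          rcases w with ⟨a, b⟩ | ⟨a, b⟩ <;> simp [hπ, eq_comm]
        rw [this, Finset.card_image_of_injective _ fun a b h => by simpa using h]; simp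
      · have : (Finset.univ.filter fun w => π w = Sum.inr v)
            = Finset.univ.image fun u : α => (Sum.inr (u, v) : (α × β) ⊕ (α × β)) := by
          ext w
          rcases w with ⟨a, b⟩ | ⟨a, b⟩ <;> simp [hπ, eq_comm]
        rw [this, Finset.card_image_of_injective _ fun a b h => by simpa using h]; simp
    simp only [hfib]
    rw [Finset.prod_ite, Finset.prod_const, Finset.prod_const]
    have hcol := color_eq_iff_of_hom hbip hconn bipGraph_isLeft_ne hg'
    obtain ⟨z⟩ := hconn.nonempty
    have hleft : (Finset.univ.filter fun x => (g x).isLeft = true).card = t ∧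
        (Finset.univ.filter fun x => ¬ (g x).isLeft = true).card = t := by
      have hc1 : (Finset.univ.filter fun x => x ∈ X₁).card = t := by
        rw [← h₁, Set.ncard_eq_toFinset_card']; congr 1; ext; simp
      have hc2 : (Finset.univ.filter fun x => x ∉ X₁).card = t := by
        rw [← h₂, hcompl, Set.ncard_eq_toFinset_card']; congr 1; ext; simp
      by_cases hz : (g z).isLeft = true ↔ z ∈ X₁
      · have : ∀ x, (g x).isLeft = true ↔ x ∈ X₁ := fun x => by
          have := hcol x z
          rw [Bool.eq_iff_iff] at this
          tauto
        simp only [this]; exact ⟨hc1, hc2⟩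
      · have : ∀ x, (g x).isLeft = true ↔ x ∉ X₁ := fun x => by
          have := hcol x z
          rw [Bool.eq_iff_iff] at this
          tauto
        simp only [this, not_not]; exact ⟨hc2, hc1⟩
    rw [hleft.1, hleft.2, mul_pow, mul_comm]

end BipartiteGraph

section Regularization

lemma two_mul_card_filter_apply_ne {W : Type} [Fintype W] [DecidableEq W] {u v : W} (h : u ≠ v) :
    2 * (Finset.univ.filter fun c : W → Bool => c u ≠ c v).card = Fintype.card (W → Bool) := by
  have hflip : (Finset.univ.filter fun c : W → Bool => c u ≠ c v).card
      = (Finset.univ.filter fun c : W → Bool => ¬ c u ≠ c v).card := by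
    refine Finset.card_nbij' (fun c => Function.update c u (!c u))
      (fun c => Function.update c u (!c u)) ?_ ?_ ?_ ?_
    · intro c hc
      simp only [Finset.coe_filter, Finset.mem_univ, true_and, Set.mem_ofPred_eq] at hc ⊢
      rw [Function.update_self, Function.update_of_ne h.symm]
      revert hc; cases c u <;> cases c v <;> simp
    · intro c hc
      simp only [Finset.coe_filter, Finset.mem_univ, true_and, Set.mem_ofPred_eq] at hc ⊢
      rw [Function.update_self, Function.update_of_ne h.symm]
      revert hc; cases c u <;> cases c v <;> simp
    · intro c _; simp
    · intro c _; simp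
  have := Finset.card_filter_add_card_filter_not (s := (Finset.univ : Finset (W → Bool)))
    (fun c => c u ≠ c v)
  rw [Finset.card_univ] at this
  omega

/-- Every graph has a cut containing at least half of its edges. -/
lemma exists_large_cut {W : Type} [Fintype W] (G : SimpleGraph W) :
    ∃ c : W → Bool, G.edgeSet.ncard
      ≤ 2 * {p : W × W | G.Adj p.1 p.2 ∧ c p.1 = false ∧ c p.2 = true}.ncard := by
  classical
  set A : Finset (W × W) := Finset.univ.filter fun p => G.Adj p.1 p.2 with hA
  have hAcard : A.card = 2 * G.edgeSet.ncard := by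
    have h1 : A.card = ∑ u, G.degree u := by
      rw [Finset.card_eq_sum_card_fiberwise (f := Prod.fst) (t := Finset.univ) (by simp)]
      refine Finset.sum_congr rfl fun u _ => ?_
      rw [← G.card_neighborFinset_eq_degree]
      refine Finset.card_nbij' Prod.snd (fun v => (u, v)) ?_ ?_ ?_ ?_
      · rintro ⟨x, y⟩ h
        simp only [hA, Finset.coe_filter, Finset.mem_filter, Finset.mem_univ, true_and,
          Set.mem_ofPred_eq] at h
        simpa [← h.2] using h.1
      · intro y h
        simpa [hA] using h
      · rintro ⟨x, y⟩ h
        simp only [Finset.coe_filter, Set.mem_ofPred_eq] at h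
        simp [← h.2]
      · intro y _; rfl
    rw [h1, G.sum_degrees_eq_twice_card_edges, Set.ncard_eq_toFinset_card', SimpleGraph.edgeFinset]
  have hsum : ∑ c : W → Bool, 2 * (A.filter fun p => c p.1 ≠ c p.2).card
      = ∑ _c : W → Bool, A.card := by
    have h := Finset.sum_card_bipartiteAbove_eq_sum_card_bipartiteBelow
      (s := (Finset.univ : Finset (W → Bool))) (t := A) (fun c p => c p.1 ≠ c p.2)
    simp only [Finset.bipartiteAbove, Finset.bipartiteBelow] at h
    rw [← Finset.mul_sum, h, Finset.mul_sum, Finset.sum_congr rfl fun p hp =>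
      two_mul_card_filter_apply_ne (G.ne_of_adj (Finset.mem_filter.mp hp).2)]
    simp [mul_comm, hA]
  obtain ⟨c, -, hc⟩ := Finset.exists_le_of_sum_le (Finset.univ_nonempty) hsum.ge
  refine ⟨c, ?_⟩
  set P := Finset.univ.filter fun p : W × W => G.Adj p.1 p.2 ∧ c p.1 = false ∧ c p.2 = true with hP
  have hsplit : (A.filter fun p => c p.1 ≠ c p.2).card ≤ P.card + (P.image Prod.swap).card := by
    refine (Finset.card_le_card ?_).trans (Finset.card_union_le _ _)
    rintro ⟨x, y⟩ h
    simp only [hA, Finset.mem_filter, Finset.mem_univ, true_and] at h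
    simp only [hP, Finset.mem_union, Finset.mem_filter, Finset.mem_univ, true_and,
      Finset.mem_image, Prod.exists, Prod.swap_prod_mk, Prod.mk.injEq]
    have hsymm := h.1.symm
    rcases hx : c x <;> rcases hy : c y
    · simp_all
    · exact Or.inl ⟨h.1, rfl, rfl⟩
    · exact Or.inr ⟨y, x, ⟨hsymm, hy, hx⟩, rfl, rfl⟩
    · simp_all
  have himg : (P.image Prod.swap).card ≤ P.card := Finset.card_image_le
  have hPn : {p : W × W | G.Adj p.1 p.2 ∧ c p.1 = false ∧ c p.2 = true}.ncard = P.card := by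
    rw [Set.ncard_eq_toFinset_card']; congr 1; ext; simp [hP]
  rw [hPn]
  omega

/-- Dyadic pigeonholing. -/
lemma exists_dyadic_class {ι : Type} (s : Finset ι) (f : ι → ℕ) {n : ℕ} (hf : ∀ u ∈ s, f u ≤ n) :
    ∃ T ⊆ s, ∃ k, 1 ≤ k ∧ ∑ u ∈ s, f u ≤ (Nat.log 2 n + 1) * ∑ u ∈ T, f u ∧
      ∀ u ∈ T, k ≤ f u ∧ f u ≤ 2 * k := by
  classical
  set T : ℕ → Finset ι := fun i => s.filter fun u => f u ≠ 0 ∧ Nat.log 2 (f u) = i with hT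
  have hsum : ∑ u ∈ s, f u = ∑ i ∈ Finset.range (Nat.log 2 n + 1), ∑ u ∈ T i, f u := by
    rw [← Finset.sum_filter_ne_zero, ← Finset.sum_fiberwise_of_maps_to
      (t := Finset.range (Nat.log 2 n + 1)) (g := fun u => Nat.log 2 (f u))]
    · simp [hT, Finset.filter_filter]
    · intro u hu
      rw [Finset.mem_range, Nat.lt_succ_iff]
      exact Nat.log_mono_right (hf u (Finset.mem_filter.mp hu).1)
  obtain ⟨i, -, hi⟩ := (Finset.range (Nat.log 2 n + 1)).exists_max_image
    (fun i => ∑ u ∈ T i, f u) ⟨0, by simp⟩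
  refine ⟨T i, Finset.filter_subset _ _, 2 ^ i, Nat.one_le_two_pow, ?_, fun u hu => ?_⟩
  · rw [hsum]
    simpa using Finset.sum_le_card_nsmul _ _ _ hi
  · simp only [hT, Finset.mem_filter] at hu
    obtain ⟨-, h0, rfl⟩ := hu
    refine ⟨Nat.pow_log_le_self 2 h0, ?_⟩
    rw [← pow_succ']
    exact (Nat.lt_pow_succ_log_self one_lt_two _).le

/-- Every relation has a large restriction whose two degrees are nearly regular. -/
lemma exists_almost_biregular {n : ℕ} (E : Fin n → Fin n → Prop) :
    ∃ (T T' : Finset (Fin n)) (D D' : ℕ),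
      {p : Fin n × Fin n | E p.1 p.2}.ncard
        ≤ (Nat.log 2 n + 1) ^ 2 * {p : T × T' | E p.1 p.2}.ncard ∧
      (∀ u : T, {v : T' | E u v}.ncard ≤ D) ∧ (∀ v : T', {u : T | E u v}.ncard ≤ D') ∧
      T.card * D ≤ 2 * (Nat.log 2 n + 1) * {p : T × T' | E p.1 p.2}.ncard ∧
      T'.card * D' ≤ 2 * (Nat.log 2 n + 1) * {p : T × T' | E p.1 p.2}.ncard ∧
      (∀ u ∈ T, ∃ v, E u v) ∧ ∀ v ∈ T', ∃ u, E u v := by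
  classical
  set f : Fin n → ℕ := fun u => (Finset.univ.filter fun v => E u v).card with hf
  obtain ⟨T, -, k, hk, hT, hTk⟩ := exists_dyadic_class Finset.univ f (n := n)
    fun u _ => (Finset.card_le_univ _).trans (by simp)
  set g : Fin n → ℕ := fun v => (T.filter fun u => E u v).card with hg
  obtain ⟨T', -, k', hk', hT', hTk'⟩ := exists_dyadic_class Finset.univ g (n := n)
    fun u _ => (Finset.card_le_univ _).trans (by simp)
  set L := Nat.log 2 n + 1
  have hfg : ∑ u ∈ T, f u = ∑ v, g v :=
    Finset.sum_card_bipartiteAbove_eq_sum_card_bipartiteBelow E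
  have he : {p : Fin n × Fin n | E p.1 p.2}.ncard = ∑ u, f u := by
    rw [Set.ncard_eq_toFinset_card',
      Finset.card_eq_sum_card_fiberwise (f := Prod.fst) (t := Finset.univ) (by simp)]
    refine Finset.sum_congr rfl fun u _ => ?_
    refine Finset.card_nbij' Prod.snd (fun v => (u, v)) ?_ ?_ ?_ ?_
    · rintro ⟨x, y⟩ h
      simp at h ⊢
      simpa [← h.2] using h.1
    · intro y h
      simpa using h
    · rintro ⟨x, y⟩ h
      simp at h ⊢
      exact h.2.symm
    · intro y _; rfl
  have he' : {p : T × T' | E p.1 p.2}.ncard = ∑ v ∈ T', g v := by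
    rw [Set.ncard_eq_toFinset_card', ← Finset.sum_coe_sort,
      Finset.card_eq_sum_card_fiberwise (f := Prod.snd) (t := Finset.univ) (by simp)]
    refine Finset.sum_congr rfl fun v _ => ?_
    refine Finset.card_bij' (fun p _ => p.1.1) (fun u hu => (⟨u, (Finset.mem_filter.mp hu).1⟩, v))
      ?_ ?_ ?_ ?_
    · rintro ⟨x, y⟩ h
      simp at h ⊢
      simpa [← h.2] using h.1
    · intro y h
      simp at h ⊢
      exact h.2
    · rintro ⟨x, y⟩ h
      simp at h ⊢
      exact h.2.symm
    · intro y _; rfl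
  refine ⟨T, T', 2 * k, 2 * k', ?_, fun u => ?_, fun v => ?_, ?_, ?_, fun u hu => ?_,
    fun v hv => ?_⟩
  · rw [he, he', pow_two, mul_assoc]
    exact hT.trans (Nat.mul_le_mul_left _ (hfg.trans_le hT'))
  · refine le_trans ?_ (hTk u u.2).2
    rw [Set.ncard_eq_toFinset_card', hf]
    exact Finset.card_le_card_of_injOn Subtype.val (fun v hv => by simpa using hv)
      Subtype.val_injective.injOn
  · refine le_trans ?_ (hTk' v v.2).2
    rw [Set.ncard_eq_toFinset_card', hg]
    exact Finset.card_le_card_of_injOn Subtype.val (fun v hv => by simpa using hv)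
      Subtype.val_injective.injOn
  · have h1 : T.card * k ≤ ∑ u ∈ T, f u := by
      simpa using Finset.card_nsmul_le_sum T f k fun u hu => (hTk u hu).1
    rw [he']
    calc T.card * (2 * k) = 2 * (T.card * k) := by ring
      _ ≤ 2 * (L * ∑ v ∈ T', g v) := Nat.mul_le_mul_left _ (h1.trans (hfg.trans_le hT'))
      _ = _ := by ring
  · have h1 : T'.card * k' ≤ ∑ v ∈ T', g v := by
      simpa using Finset.card_nsmul_le_sum T' g k' fun u hu => (hTk' u hu).1
    rw [he']
    calc T'.card * (2 * k') = 2 * 1 * (T'.card * k') := by ring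
      _ ≤ 2 * L * ∑ v ∈ T', g v :=
        Nat.mul_le_mul (Nat.mul_le_mul_left _ (Nat.succ_le_succ (Nat.zero_le _))) h1
  · obtain ⟨v, hv⟩ := Finset.card_pos.mp (hk.trans (hTk u hu).1)
    exact ⟨v, (Finset.mem_filter.mp hv).2⟩
  · obtain ⟨u, hu⟩ := Finset.card_pos.mp (hk'.trans (hTk' v hv).1)
    exact ⟨u, (Finset.mem_filter.mp hu).2⟩

end Regularization

section Relation

variable {V : Type} [Fintype V] {H : SimpleGraph V}

lemma SatisfiesSidorenko.bipartite_count (hsid : SatisfiesSidorenko H) {X₁ X₂ : Set V}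
    (hbip : IsBipartitionOf H X₁ X₂) (hconn : H.Connected) {t d : ℕ} (h₁ : X₁.ncard = t)
    (h₂ : X₂.ncard = t) (hV : Fintype.card V = 2 * t) (he : H.edgeSet.ncard = d * t)
    {α β : Type} [Fintype α] [Fintype β] (E : α → β → Prop)
    (hpos : 0 < Fintype.card α * Fintype.card β) :
    (Fintype.card α * Fintype.card β) ^ t * {p : α × β | E p.1 p.2}.ncard ^ (d * t)
      ≤ 2 ^ (d * t) * (Fintype.card α * Fintype.card β) ^ (d * t)
        * (homsConstOn H (bipGraph E) ∅).card := by
  have h := hsid.le_card_homsConstOn (W := (α × β) ⊕ (α × β)) (by simpa using hpos)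
    (bipGraph (balancedBlowup E))
  have hb := card_homs_balancedBlowup_le E hbip hconn h₁ h₂
  rw [ncard_edgeSet_bipGraph, ncard_balancedBlowup, hV, he] at h
  simp only [Fintype.card_sum, Fintype.card_prod] at h
  set S := Fintype.card α * Fintype.card β
  set e := {p : α × β | E p.1 p.2}.ncard
  set N := (homsConstOn H (bipGraph E) ∅).card
  have hS : (0 : ℝ) < S := by exact_mod_cast hpos
  have h2 : ((S + S : ℕ) : ℝ) ^ (2 * t)
      * (2 * ((e * S : ℕ) : ℝ) / ((S + S : ℕ) : ℝ) ^ 2) ^ (d * t) ≤ (S : ℝ) ^ t * N :=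
    h.trans (by exact_mod_cast hb)
  have h3 : 2 * ((e * S : ℕ) : ℝ) / ((S + S : ℕ) : ℝ) ^ 2 = e / (2 * S) := by
    push_cast
    field_simp
    ring
  have h4 : ((S + S : ℕ) : ℝ) ^ (2 * t) = 4 ^ t * (S : ℝ) ^ t * (S : ℝ) ^ t := by
    push_cast
    rw [← two_mul, pow_mul, mul_pow, ← mul_pow, ← mul_pow]
    ring
  rw [h3, h4, div_pow, mul_div_assoc', div_le_iff₀ (by positivity)] at h2
  have h5 : (1 : ℝ) ≤ 4 ^ t := one_le_pow₀ (by norm_num)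
  have h6 : (S : ℝ) ^ t * ((S : ℝ) ^ t * e ^ (d * t))
      ≤ (S : ℝ) ^ t * (2 ^ (d * t) * S ^ (d * t) * N) := by
    calc (S : ℝ) ^ t * ((S : ℝ) ^ t * e ^ (d * t))
        ≤ 4 ^ t * ((S : ℝ) ^ t * ((S : ℝ) ^ t * e ^ (d * t))) :=
          le_mul_of_one_le_left (by positivity) h5
      _ = 4 ^ t * (S : ℝ) ^ t * (S : ℝ) ^ t * e ^ (d * t) := by ring
      _ ≤ _ := h2
      _ = _ := by rw [mul_pow]; ring
  exact_mod_cast le_of_mul_le_mul_left h6 (by positivity)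

lemma exists_card_relation_pow_le {X₁ X₂ : Set V} (hbip : IsBipartitionOf H X₁ X₂)
    (hconn : H.Connected) (hrefl : IsReflective H X₁ X₂) (hsid : SatisfiesSidorenko H)
    {t d : ℕ} (ht : 0 < t) (h₁ : X₁.ncard = t) (h₂ : X₂.ncard = t)
    (hV : Fintype.card V = 2 * t) (he : H.edgeSet.ncard = (d + 2) * t) :
    ∃ C : ℕ, ∀ (α β : Type) [Fintype α] [Fintype β] (E : α → β → Prop) (D D' L n : ℕ),
      Fintype.card α ≤ n → Fintype.card β ≤ n →
      (∀ u, {v | E u v}.ncard ≤ D) → (∀ v, {u | E u v}.ncard ≤ D') →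
      Fintype.card α * D ≤ L * {p : α × β | E p.1 p.2}.ncard →
      Fintype.card β * D' ≤ L * {p : α × β | E p.1 p.2}.ncard →
      ¬ ContainsCopy H (bipGraph E) →
      {p : α × β | E p.1 p.2}.ncard ^ ((d + 1) * t)
        ≤ C * L ^ t * n ^ ((2 * d + 1) * t + 1) := by
  obtain ⟨C, hC⟩ := exists_card_homsConstOn_empty_le hbip hconn hrefl
  refine ⟨4 * 2 ^ ((d + 2) * t) * C, ?_⟩
  intro α β _ _ E D D' L n ha hb hD hD' haD hbD hfree
  have hN := hC _ (bipGraph E) Sum.isLeft bipGraph_isLeft_ne hfree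
  have hcompl : X₂ = X₁ᶜ := (IsCompl.compl_eq ⟨hbip.1, codisjoint_iff.mpr hbip.2.1⟩).symm
  have hcompl' : X₁ = X₂ᶜ := by rw [hcompl, compl_compl]
  have hne₁ : X₁.Nonempty := Set.nonempty_of_ncard_ne_zero (by omega)
  have hne₂ : X₂.Nonempty := Set.nonempty_of_ncard_ne_zero (by omega)
  have hnt : Nontrivial V := by
    obtain ⟨x, hx⟩ := hne₁
    obtain ⟨y, hy⟩ := hne₂
    exact ⟨x, y, fun h => Set.disjoint_left.mp hbip.1 hx (h ▸ hy)⟩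
  have hnbr : ∀ y : V, ∃ x, H.Adj x y := fun y => by
    obtain ⟨x, hx⟩ := hconn.preconnected.exists_adj_of_nontrivial y
    exact ⟨x, hx.symm⟩
  have hX₁ := card_homsConstOn_le_sum_degree_pow (G := bipGraph E) (H := H) hne₁ fun y hy => by
    obtain ⟨x, hx⟩ := hnbr y
    rcases hbip.2.2 hx with h | h
    · exact ⟨x, h.1, hx⟩
    · exact absurd h.2 hy
  have hX₂ := card_homsConstOn_le_sum_degree_pow (G := bipGraph E) (H := H) hne₂ fun y hy => by
    obtain ⟨x, hx⟩ := hnbr y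
    rcases hbip.2.2 hx with h | h
    · exact absurd h.2 hy
    · exact ⟨x, h.1, hx⟩
  rw [← hcompl, h₂] at hX₁
  rw [← hcompl', h₁] at hX₂
  have hdeg := sum_degree_pow_bipGraph_le E t D D' hD hD'
  have hdpos : (d + 1) * t ≠ 0 := (Nat.mul_pos (Nat.succ_pos d) ht).ne'
  rcases Nat.eq_zero_or_pos {p : α × β | E p.1 p.2}.ncard with he0 | he0
  · rw [he0, zero_pow hdpos]
    exact Nat.zero_le _
  obtain ⟨p, -⟩ := Set.nonempty_of_ncard_ne_zero he0.ne'
  have hapos : 0 < Fintype.card α := Fintype.card_pos_iff.mpr ⟨p.1⟩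
  have hbpos : 0 < Fintype.card β := Fintype.card_pos_iff.mpr ⟨p.2⟩
  have hcount := hsid.bipartite_count hbip hconn h₁ h₂ hV he E (Nat.mul_pos hapos hbpos)
  set e := {p : α × β | E p.1 p.2}.ncard
  set N := (homsConstOn H (bipGraph E) ∅).card
  set a := Fintype.card α
  set b := Fintype.card β
  set K := 2 ^ ((d + 2) * t)
  have hN' : N ≤ C * (2 * (a * D ^ t + b * D' ^ t)) :=
    hN.trans (Nat.mul_le_mul_left _ (by omega))
  have h1 : ((a * b) ^ (2 * t) * e ^ t) * e ^ ((d + 1) * t)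
      ≤ ((a * b) ^ (2 * t) * e ^ t)
        * (2 * K * C * L ^ t * ((a * b) ^ (d * t) * (a * b ^ t + b * a ^ t))) := by
    calc ((a * b) ^ (2 * t) * e ^ t) * e ^ ((d + 1) * t)
        = (a * b) ^ t * ((a * b) ^ t * e ^ ((d + 2) * t)) := by ring
      _ ≤ (a * b) ^ t * (K * (a * b) ^ ((d + 2) * t) * (C * (2 * (a * D ^ t + b * D' ^ t)))) :=
          Nat.mul_le_mul_left _ (hcount.trans (Nat.mul_le_mul_left _ hN'))
      _ = 2 * K * C * (a * b) ^ ((d + 2) * t)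
          * (a * b ^ t * (a * D) ^ t + b * a ^ t * (b * D') ^ t) := by ring
      _ ≤ 2 * K * C * (a * b) ^ ((d + 2) * t)
          * (a * b ^ t * (L * e) ^ t + b * a ^ t * (L * e) ^ t) := by gcongr
      _ = _ := by ring
  have h2 := Nat.le_of_mul_le_mul_left h1
    (Nat.mul_pos (pow_pos (Nat.mul_pos hapos hbpos) _) (pow_pos he0 _))
  calc e ^ ((d + 1) * t)
      ≤ 2 * K * C * L ^ t * ((a * b) ^ (d * t) * (a * b ^ t + b * a ^ t)) := h2
    _ ≤ 2 * K * C * L ^ t * ((n * n) ^ (d * t) * (n * n ^ t + n * n ^ t)) := by gcongr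
    _ = _ := by ring

end Relation

section Structure

variable {V : Type} [Fintype V] {H : SimpleGraph V}

lemma IsBipartitionOf.card_eq_of_regular {X₁ X₂ : Set V} (hbip : IsBipartitionOf H X₁ X₂) {d : ℕ}
    (hd : 0 < d) (hreg : ∀ v, deg H v = d) :
    X₂.ncard = X₁.ncard ∧ Fintype.card V = 2 * X₁.ncard ∧ H.edgeSet.ncard = d * X₁.ncard := by
  classical
  have hdeg : ∀ v, H.degree v = d := fun v => by
    rw [← hreg v, deg, Set.ncard_eq_toFinset_card', ← H.card_neighborFinset_eq_degree]
    rfl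
  have hw : H.IsBipartiteWith (X₁.toFinset : Set V) (X₂.toFinset : Set V) := by
    simpa using (⟨hbip.1, hbip.2.2⟩ : H.IsBipartiteWith X₁ X₂)
  have h1 := isBipartiteWith_sum_degrees_eq hw
  have h2 := isBipartiteWith_sum_degrees_eq_card_edges hw
  simp only [hdeg, Finset.sum_const, smul_eq_mul, ← Set.ncard_eq_toFinset_card'] at h1 h2
  have h3 : X₂.ncard = X₁.ncard := (Nat.eq_of_mul_eq_mul_right hd h1).symm
  refine ⟨h3, ?_, ?_⟩
  · have := Set.ncard_union_eq hbip.1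
    rw [hbip.2.1, Set.ncard_univ, Nat.card_eq_fintype_card] at this
    omega
  · rw [Set.ncard_eq_toFinset_card', ← SimpleGraph.edgeFinset, ← h2, mul_comm]

lemma nonempty_iso_completeBipartiteGraph {X₁ X₂ : Set V} (hbip : IsBipartitionOf H X₁ X₂) {d : ℕ}
    (h₁ : X₁.ncard = d) (h₂ : X₂.ncard = d) (hadj : ∀ x ∈ X₁, ∀ y ∈ X₂, H.Adj x y) :
    Nonempty (H ≃g completeBipartiteGraph (Fin d) (Fin d)) := by
  classical
  have hcompl : X₂ = X₁ᶜ := (IsCompl.compl_eq ⟨hbip.1, codisjoint_iff.mpr hbip.2.1⟩).symm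
  subst hcompl
  have e₁ : X₁ ≃ Fin d := Finite.equivFinOfCardEq h₁
  have e₂ : (X₁ᶜ : Set V) ≃ Fin d := Finite.equivFinOfCardEq h₂
  let e : V ≃ Fin d ⊕ Fin d := (Equiv.Set.sumCompl X₁).symm.trans (Equiv.sumCongr e₁ e₂)
  have he₁ : ∀ x ∈ X₁, (e x).isLeft = true ∧ (e x).isRight = false := fun x hx => by
    simp [e, Equiv.Set.sumCompl_symm_apply_of_mem hx]
  have he₂ : ∀ x ∉ X₁, (e x).isLeft = false ∧ (e x).isRight = true := fun x hx => by
    simp [e, Equiv.Set.sumCompl_symm_apply_of_notMem hx]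
  refine ⟨⟨e, fun {x y} => ?_⟩⟩
  have h : H.Adj x y → (x ∈ X₁ ∧ y ∈ X₁ᶜ) ∨ (x ∈ X₁ᶜ ∧ y ∈ X₁) := fun hxy => hbip.2.2 hxy
  by_cases hx : x ∈ X₁ <;> by_cases hy : y ∈ X₁
  · simp only [completeBipartiteGraph_adj, he₁ x hx, he₁ y hy]
    simp only [Set.mem_compl_iff] at h
    constructor
    · simp
    · intro hh; rcases h hh with h | h <;> tauto
  · simp [completeBipartiteGraph_adj, he₁ x hx, he₂ y hy, hadj x hx y hy]
  · simp [completeBipartiteGraph_adj, he₂ x hx, he₁ y hy, (hadj y hy x hx).symm]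
  · simp only [completeBipartiteGraph_adj, he₂ x hx, he₂ y hy]
    simp only [Set.mem_compl_iff] at h
    constructor
    · simp
    · intro hh; rcases h hh with h | h <;> tauto

lemma IsBipartitionOf.degree_lt_card {X₁ X₂ : Set V} (hbip : IsBipartitionOf H X₁ X₂) {d : ℕ}
    (hd : 0 < d) (hreg : ∀ v, deg H v = d) (hconn : H.Connected)
    (hnotKdd : IsEmpty (H ≃g completeBipartiteGraph (Fin d) (Fin d))) : d < X₁.ncard := by
  obtain ⟨h21, hV, -⟩ := hbip.card_eq_of_regular hd hreg
  have hsub : ∀ x ∈ X₁, H.neighborSet x ⊆ X₂ := fun x hx y hy => by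
    rcases hbip.2.2 hy with h | h
    · exact h.2
    · exact absurd hx fun hx => Set.disjoint_left.mp hbip.1 hx h.1
  obtain ⟨z⟩ := hconn.nonempty
  have hpos : 0 < X₁.ncard := by
    have := Fintype.card_pos_iff.mpr ⟨z⟩
    omega
  obtain ⟨x, hx⟩ := Set.nonempty_of_ncard_ne_zero hpos.ne'
  have hle : d ≤ X₁.ncard := by
    rw [← hreg x, ← h21]
    exact Set.ncard_le_ncard (hsub x hx)
  refine lt_of_le_of_ne hle fun heq => ?_
  obtain ⟨i⟩ := nonempty_iso_completeBipartiteGraph hbip heq.symm (h21.trans heq.symm)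
    fun x hx y hy => by
      have : H.neighborSet x = X₂ := Set.eq_of_subset_of_ncard_le (hsub x hx) (by
        rw [h21, ← heq]; exact (hreg x).ge)
      rw [← this] at hy
      exact hy
  exact hnotKdd.false i

end Structure

section Asymptotics

lemma exists_log_le_rpow {δ : ℝ} (hδ : 0 < δ) :
    ∃ C : ℝ, 0 < C ∧ ∀ n : ℕ, 1 ≤ n → ((Nat.log 2 n + 1 : ℕ) : ℝ) ≤ C * (n : ℝ) ^ δ := by
  have hl : 0 < Real.log 2 := Real.log_pos one_lt_two
  refine ⟨1 / (δ * Real.log 2) + 1, by positivity, fun n hn => ?_⟩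
  have hn' : (1 : ℝ) ≤ n := by exact_mod_cast hn
  have h1 : (Nat.log 2 n : ℝ) * Real.log 2 ≤ Real.log n := by
    rw [← Real.log_pow]
    exact Real.log_le_log (by positivity) (by
      exact_mod_cast Nat.pow_log_le_self 2 (by omega : n ≠ 0))
  have h2 := Real.log_le_rpow_div (by linarith : (0 : ℝ) ≤ n) hδ
  have h3 : (1 : ℝ) ≤ (n : ℝ) ^ δ := Real.one_le_rpow hn' hδ.le
  have h4 : (Nat.log 2 n : ℝ) ≤ (n : ℝ) ^ δ / δ / Real.log 2 := by
    rw [le_div_iff₀ hl]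
    exact h1.trans h2
  push_cast
  calc (Nat.log 2 n : ℝ) + 1 ≤ (n : ℝ) ^ δ / δ / Real.log 2 + (n : ℝ) ^ δ := add_le_add h4 h3
    _ = _ := by field_simp

lemma exists_edgeSet_ncard_pow_le {V : Type} [Fintype V] {H : SimpleGraph V} {X₁ X₂ : Set V}
    (hbip : IsBipartitionOf H X₁ X₂) (hconn : H.Connected) (hrefl : IsReflective H X₁ X₂)
    (hsid : SatisfiesSidorenko H)
    {t d : ℕ} (ht : 0 < t) (h₁ : X₁.ncard = t) (h₂ : X₂.ncard = t)
    (hV : Fintype.card V = 2 * t) (he : H.edgeSet.ncard = (d + 2) * t) :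
    ∃ C : ℕ, ∀ (n : ℕ) (G : SimpleGraph (Fin n)), ¬ ContainsCopy H G →
      G.edgeSet.ncard ^ ((d + 1) * t)
        ≤ C * (Nat.log 2 n + 1) ^ (2 * ((d + 1) * t) + t) * n ^ ((2 * d + 1) * t + 1) := by
  obtain ⟨C, hC⟩ := exists_card_relation_pow_le hbip hconn hrefl hsid ht h₁ h₂ hV he
  refine ⟨2 ^ ((d + 1) * t) * C * 2 ^ t, fun n G hG => ?_⟩
  obtain ⟨c, hc⟩ := exists_large_cut G
  obtain ⟨T, T', D, D', h1, h2, h3, h4, h5, h6, h7⟩ := exists_almost_biregular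
    fun u v => G.Adj u v ∧ c u = false ∧ c v = true
  set E : T → T' → Prop := fun u v => G.Adj u v ∧ c u = false ∧ c v = true with hE
  have hfree : ¬ ContainsCopy H (bipGraph E) := by
    rintro ⟨f, hf⟩
    have hinj : Function.Injective
        (Sum.elim (Subtype.val : T → Fin n) (Subtype.val : T' → Fin n)) := by
      refine Subtype.val_injective.sumElim Subtype.val_injective fun u v huv => ?_
      obtain ⟨_, -, hu, -⟩ := h6 u u.2
      obtain ⟨_, -, -, hv⟩ := h7 v v.2
      rw [huv, hv] at hu
      exact absurd hu (by simp)
    refine hG ⟨⟨fun x => Sum.elim (Subtype.val : T → Fin n) (Subtype.val : T' → Fin n) (f x),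
      fun {x y} hxy => ?_⟩, fun x y h => hf (hinj h)⟩
    have := f.map_adj hxy
    revert this
    rcases f x with u | u <;> rcases f y with v | v <;> simp [hE]
    · tauto
    · intro h _ _; exact h.symm
  have hcard : ∀ S : Finset (Fin n), S.card ≤ n := fun S => (Finset.card_le_univ S).trans (by simp)
  have hfin := hC T T' E D D' (2 * (Nat.log 2 n + 1)) n (by simpa using hcard T)
    (by simpa using hcard T') h2 h3 (by simpa using h4) (by simpa using h5) hfree
  set L := Nat.log 2 n + 1
  set e := {p : T × T' | E p.1 p.2}.ncard
  calc G.edgeSet.ncard ^ ((d + 1) * t) ≤ (2 * (L ^ 2 * e)) ^ ((d + 1) * t) :=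
        Nat.pow_le_pow_left (hc.trans (Nat.mul_le_mul_left _ h1)) _
    _ = 2 ^ ((d + 1) * t) * L ^ (2 * ((d + 1) * t)) * e ^ ((d + 1) * t) := by
        rw [mul_pow, mul_pow, ← pow_mul, mul_assoc]
    _ ≤ 2 ^ ((d + 1) * t) * L ^ (2 * ((d + 1) * t))
        * (C * (2 * L) ^ t * n ^ ((2 * d + 1) * t + 1)) := Nat.mul_le_mul_left _ hfin
    _ = _ := by rw [mul_pow 2 L]; ring

lemma exists_rpow_bound_of_pow_le {d t C r : ℕ} (ht : d + 3 ≤ t) :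
    ∃ ε C' : ℝ, 0 < ε ∧ 0 < C' ∧ ∀ n e : ℕ, 1 ≤ n →
      e ^ ((d + 1) * t) ≤ C * (Nat.log 2 n + 1) ^ r * n ^ ((2 * d + 1) * t + 1) →
      (e : ℝ) ≤ C' * (n : ℝ) ^ ((2 : ℝ) - 1 / ((d + 2 : ℕ) : ℝ) - ε) := by
  set k : ℕ := (d + 1) * t with hk
  have hkpos : 0 < k := Nat.mul_pos (Nat.succ_pos d) (by omega)
  have hkR : (0 : ℝ) < k := by exact_mod_cast hkpos
  set D : ℝ := ((d + 2 : ℕ) : ℝ) with hD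
  have hDpos : 0 < D := by rw [hD]; positivity
  set δ : ℝ := 1 / (2 * D * (r + 1)) with hδ
  obtain ⟨K, hK, hlog⟩ := exists_log_le_rpow (δ := δ) (by positivity)
  refine ⟨1 / (2 * D * k), max (C * K ^ r) 1, by positivity, by positivity, fun n e hn h => ?_⟩
  have hn' : (1 : ℝ) ≤ n := by exact_mod_cast hn
  have hn0 : (0 : ℝ) ≤ n := by linarith
  set M := max ((C : ℝ) * K ^ r) 1
  have hM1 : 1 ≤ M := le_max_right _ _
  have hMC : C * K ^ r ≤ M := le_max_left _ _
  refine le_of_pow_le_pow_left₀ hkpos.ne' (by positivity) ?_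
  have hR : (e : ℝ) ^ k ≤ C * ((Nat.log 2 n + 1 : ℕ) : ℝ) ^ r * n ^ ((2 * d + 1) * t + 1) := by
    exact_mod_cast h
  have hδr : δ * r ≤ 1 / (2 * D) := by
    rw [hδ, div_mul_eq_mul_div, one_mul, div_le_div_iff₀ (by positivity) (by positivity)]
    nlinarith
  have hexp : δ * r + (((2 * d + 1) * t + 1 : ℕ) : ℝ) ≤ (2 - 1 / D - 1 / (2 * D * k)) * k := by
    have e1 : (2 - 1 / D - 1 / (2 * D * k)) * k = 2 * k - k / D - 1 / (2 * D) := by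
      field_simp
    have hkD : (k : ℝ) / D = t - t / D := by
      rw [hk, hD]; push_cast; field_simp; ring
    have htD : 1 + 1 / D ≤ t / D := by
      rw [le_div_iff₀ hDpos, add_mul, one_div_mul_cancel hDpos.ne', hD]
      have : ((d + 3 : ℕ) : ℝ) ≤ t := by exact_mod_cast ht
      push_cast at this ⊢
      linarith
    have hhalf : 1 / D = 1 / (2 * D) + 1 / (2 * D) := by field_simp; norm_num
    rw [e1, hkD, hk]
    push_cast
    nlinarith
  calc (e : ℝ) ^ k ≤ C * ((Nat.log 2 n + 1 : ℕ) : ℝ) ^ r * n ^ ((2 * d + 1) * t + 1) := hR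
    _ ≤ C * (K * (n : ℝ) ^ δ) ^ r * n ^ ((2 * d + 1) * t + 1) := by
        gcongr
        exact hlog n hn
    _ = C * K ^ r * (n : ℝ) ^ (δ * r + (((2 * d + 1) * t + 1 : ℕ) : ℝ)) := by
        rw [Real.rpow_add (by linarith), Real.rpow_mul hn0, Real.rpow_natCast, Real.rpow_natCast,
          mul_pow]
        ring
    _ ≤ M ^ k * (n : ℝ) ^ ((2 - 1 / D - 1 / (2 * D * k)) * k) := by
        gcongr
        · exact hMC.trans (le_self_pow₀ hM1 hkpos.ne')
    _ = _ := by rw [mul_pow, Real.rpow_mul hn0, Real.rpow_natCast]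

end Asymptotics

/-- Let `H` be a `d`-regular, reflective, connected bipartite graph satisfying
Sidorenko's conjecture which is not isomorphic to `K_{d,d}`. Then there exist `ε > 0`
and `C > 0` such that `ex(n, H) ≤ C · n^(2 - 1/d - ε)` for all `n`. -/
theorem turan_number_reflective_regular {V : Type} [Fintype V]
    (H : SimpleGraph V) (X₁ X₂ : Set V) (hbip : IsBipartitionOf H X₁ X₂)
    (hconn : H.Connected) (hrefl : IsReflective H X₁ X₂)
    (hsid : SatisfiesSidorenko H) (d : ℕ) (hreg : ∀ v, deg H v = d)
    (hnotKdd : IsEmpty (H ≃g completeBipartiteGraph (Fin d) (Fin d))) :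
    ∃ ε C : ℝ, 0 < ε ∧ 0 < C ∧ ∀ (n : ℕ) (G : SimpleGraph (Fin n)),
      ¬ ContainsCopy H G →
      (G.edgeSet.ncard : ℝ) ≤ C * (n : ℝ) ^ ((2 : ℝ) - 1 / (d : ℝ) - ε) := by
  classical
  have hedge0 : ∀ G : SimpleGraph (Fin 0), G.edgeSet.ncard = 0 := fun G => by
    simp [Subsingleton.elim G ⊥]
  have hconnE := hconn.card_vert_le_card_edgeSet_add_one
  rcases Nat.eq_zero_or_pos d with rfl | hd
  · have hsub : Subsingleton V := by
      by_contra hnt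
      rw [not_subsingleton_iff_nontrivial] at hnt
      obtain ⟨x⟩ := hconn.nonempty
      obtain ⟨y, hy⟩ := hconn.preconnected.exists_adj_of_nontrivial x
      have h0 : H.neighborSet x = ∅ := (Set.ncard_eq_zero (Set.toFinite _)).mp (hreg x)
      have : y ∈ H.neighborSet x := hy
      simp [h0] at this
    refine ⟨1, 1, one_pos, one_pos, fun n G hG => ?_⟩
    rcases Nat.eq_zero_or_pos n with rfl | hn
    · rw [hedge0, Nat.cast_zero]
      positivity
    · exact absurd ⟨⟨fun _ => ⟨0, hn⟩, fun {x y} h => absurd (Subsingleton.elim x y) h.ne⟩,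
        Function.injective_of_subsingleton _⟩ hG
  · obtain ⟨h21, hV, hE⟩ := hbip.card_eq_of_regular hd hreg
    have hlt := hbip.degree_lt_card hd hreg hconn hnotKdd
    have hd2 : 2 ≤ d := by
      by_contra hcon
      obtain rfl : d = 1 := by omega
      rw [Nat.card_eq_fintype_card, hV, Nat.card_coe_set_eq, hE] at hconnE
      omega
    obtain ⟨d, rfl⟩ := Nat.exists_eq_add_of_le' hd2
    obtain ⟨C, hC⟩ := exists_edgeSet_ncard_pow_le hbip hconn hrefl hsid
      (t := X₁.ncard) (by omega) rfl h21 hV hE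
    obtain ⟨ε, C', hε, hC', hfin⟩ := exists_rpow_bound_of_pow_le (C := C)
      (r := 2 * ((d + 1) * X₁.ncard) + X₁.ncard) (d := d) (t := X₁.ncard) (by omega)
    refine ⟨ε, C', hε, hC', fun n G hG => ?_⟩
    rcases Nat.eq_zero_or_pos n with rfl | hn
    · rw [hedge0, Nat.cast_zero]
      positivity
    · exact hfin n _ hn (hC n G hG)
end

section
/- Let G be a finite properly edge-coloured graph with minimum degree δ(G) > 0 and let k ≥ 2 be an integer. Then h_{2k}(1, 2k) ≤ h_{2k-2} / δ(G), where h_{2k-2} is the total weight of all homomorphic cycles of length 2k-2 in G. -/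
open SimpleGraph Finset
open scoped Classical

/-- The cyclic successor of an index `i : Fin m` (i.e. `i + 1` mod `m`). -/
def cyclicSucc {m : ℕ} (i : Fin m) : Fin m := ⟨(i.val + 1) % m, Nat.mod_lt _ i.pos⟩

/-- `u : Fin m → V` is a homomorphic cycle of length `m` in `G`: consecutive vertices
(cyclically, indices mod `m`) are adjacent. -/
def IsHomCycle {V : Type} (G : SimpleGraph V) {m : ℕ} (u : Fin m → V) : Prop :=
  ∀ i : Fin m, G.Adj (u i) (u (cyclicSucc i))

/-- `h_m`: the sum of the weights `1/∏ᵢ d(uᵢ)` of all homomorphic cycles of length `m`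
in `G`. -/
noncomputable def homCycleSum {V : Type} [Fintype V] (G : SimpleGraph V)
    [DecidableRel G.Adj] (m : ℕ) : ℝ :=
  ∑ u : Fin m → V, if IsHomCycle G u then ∏ i, ((G.degree (u i) : ℝ))⁻¹ else 0

/-- `h_m(a+1, b+1)` (edges indexed so that the `a`-th edge of the cycle is
`u_a u_{a+1}`): the sum of the weights of the homomorphic `m`-cycles whose edges
`u_a u_{a+1}` and `u_b u_{b+1}` receive the same colour under `c`. -/
noncomputable def homCyclePairSum {V : Type} [Fintype V] (G : SimpleGraph V)
    [DecidableRel G.Adj] {β : Type} (c : Sym2 V → β) {m : ℕ} (a b : Fin m) : ℝ :=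
  ∑ u : Fin m → V,
    if IsHomCycle G u ∧ c s(u a, u (cyclicSucc a)) = c s(u b, u (cyclicSucc b)) then
      ∏ i, ((G.degree (u i) : ℝ))⁻¹
    else 0

theorem IsProperEdgeColoring.eq_of_color_eq_s19 {V β : Type} {G : SimpleGraph V}
    {c : Sym2 V → β} (hc : IsProperEdgeColoring G c) {x y z : V} (hy : G.Adj x y)
    (hz : G.Adj z x) (h : c s(x, y) = c s(z, x)) : z = y := by
  by_contra hne
  refine hc (e₁ := s(x, y)) (e₂ := s(z, x)) hy hz ?_ ⟨x, by simp, by simp⟩ h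
  rw [Sym2.eq_swap, Ne, Sym2.congr_left]
  exact fun h => hne h.symm

/-- Deleting the first and last vertices of a homomorphic cycle leaves a homomorphic cycle,
provided that the last vertex coincides with the second one. -/
theorem IsHomCycle.of_cons_snoc {V : Type} {G : SimpleGraph V} {p : ℕ} {x : V}
    {w : Fin (p + 1) → V}
    (h : IsHomCycle G (m := p + 3) (Fin.cons x (Fin.snoc w (w 0) : Fin (p + 2) → V))) :
    IsHomCycle G w := by
  intro i
  have hi := h i.castSucc.succ
  rw [Fin.cons_succ, Fin.snoc_castSucc] at hi
  have hs : cyclicSucc i.castSucc.succ = i.succ.succ :=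
    Fin.ext (Nat.mod_eq_of_lt (by simp; omega))
  rw [hs, Fin.cons_succ] at hi
  rcases Fin.eq_castSucc_or_eq_last i with ⟨j, rfl⟩ | rfl
  · rw [Fin.succ_castSucc, Fin.snoc_castSucc] at hi
    convert hi using 2
    exact Fin.ext (Nat.mod_eq_of_lt (by simp))
  · rw [Fin.succ_last, Fin.snoc_last] at hi
    convert hi using 2
    exact Fin.ext (by simp [cyclicSucc])

theorem sum_fun_eq_sum_cons_snoc {V M : Type*} [Fintype V] [AddCommMonoid M] (n : ℕ)
    (F : (Fin (n + 2) → V) → M) :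
    ∑ u, F u = ∑ w : Fin n → V, ∑ x : V, ∑ y : V,
      F (Fin.cons x (Fin.snoc w y : Fin (n + 1) → V)) := by
  rw [← (Fin.consEquiv fun _ : Fin (n + 2) => V).sum_comp, Fintype.sum_prod_type,
    Finset.sum_comm (s := (univ : Finset (Fin n → V)))]
  refine Finset.sum_congr rfl fun x _ => ?_
  rw [← (Fin.snocEquiv fun _ : Fin (n + 1) => V).sum_comp, Fintype.sum_prod_type,
    Finset.sum_comm]
  rfl

theorem prod_cons_snoc {V M : Type*} [CommMonoid M] (f : V → M) {n : ℕ} (x y : V)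
    (w : Fin n → V) :
    ∏ i, f ((Fin.cons x (Fin.snoc w y : Fin (n + 1) → V) : Fin (n + 2) → V) i) =
      f x * ((∏ i, f (w i)) * f y) := by
  simp [Fin.prod_univ_succ (n := n + 1), Fin.prod_univ_castSucc]

theorem sum_adj_inv_degree_mul_inv_degree_le {V : Type} [Fintype V] (G : SimpleGraph V)
    [DecidableRel G.Adj] (hδ : 0 < G.minDegree) (v : V) :
    ∑ x, (if G.Adj v x then ((G.degree x : ℝ))⁻¹ * ((G.degree v : ℝ))⁻¹ else 0) ≤
      ((G.minDegree : ℝ))⁻¹ := by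
  have hδ' : (0 : ℝ) < G.minDegree := by exact_mod_cast hδ
  have hv : (0 : ℝ) < G.degree v := by exact_mod_cast hδ.trans_le (G.minDegree_le_degree v)
  calc
    _ ≤ ∑ x, (if G.Adj v x then ((G.minDegree : ℝ))⁻¹ * ((G.degree v : ℝ))⁻¹ else 0) := by
      refine Finset.sum_le_sum fun x _ => ?_
      have hx : (G.minDegree : ℝ) ≤ G.degree x := by exact_mod_cast G.minDegree_le_degree x
      split_ifs
      · gcongr
      · rfl
    _ = G.degree v * (((G.minDegree : ℝ))⁻¹ * ((G.degree v : ℝ))⁻¹) := by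
      rw [← Finset.sum_filter, ← G.neighborFinset_eq_filter, Finset.sum_const,
        G.card_neighborFinset_eq_degree, nsmul_eq_mul]
    _ = ((G.minDegree : ℝ))⁻¹ := by field_simp

theorem homCyclePairSum_zero_last_le {V : Type} [Fintype V]
    (G : SimpleGraph V) [DecidableRel G.Adj] (hδ : 0 < G.minDegree)
    {β : Type} (c : Sym2 V → β) (hc : IsProperEdgeColoring G c) (p : ℕ) :
    homCyclePairSum G c (0 : Fin (p + 3)) (Fin.last (p + 2)) ≤
      homCycleSum G (p + 1) / (G.minDegree : ℝ) := by
  have hzero : cyclicSucc (0 : Fin (p + 3)) = Fin.succ (Fin.castSucc 0) :=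
    Fin.ext (Nat.mod_eq_of_lt (by simp))
  have hlast : cyclicSucc (Fin.last (p + 2)) = 0 := Fin.ext (by simp [cyclicSucc])
  rw [homCyclePairSum, homCycleSum, sum_fun_eq_sum_cons_snoc, Finset.sum_div]
  refine Finset.sum_le_sum fun w _ => ?_
  set P : ℝ := ∏ i, ((G.degree (w i) : ℝ))⁻¹ with hP
  have hP0 : 0 ≤ P := by positivity
  calc
    _ ≤ ∑ x, ∑ y, (if y = w 0 then (if IsHomCycle G w then
          (if G.Adj (w 0) x then ((G.degree x : ℝ))⁻¹ * ((G.degree (w 0) : ℝ))⁻¹ else 0) * P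
            else 0) else 0) := by
      refine Finset.sum_le_sum fun x _ => Finset.sum_le_sum fun y _ => ?_
      split_ifs with h hy hw ha hw ha
      all_goals try positivity
      · subst hy
        rw [prod_cons_snoc (fun v => ((G.degree v : ℝ))⁻¹), ← hP]
        exact le_of_eq (by ring)
      all_goals
        exfalso
        obtain ⟨h, hcol⟩ := h
        have h0 := h 0
        have h1 := h (Fin.last _)
        rw [hzero, hlast, ← Fin.succ_last] at hcol
        rw [hzero] at h0
        rw [hlast, ← Fin.succ_last] at h1
        simp only [Fin.cons_zero, Fin.cons_succ, Fin.snoc_castSucc, Fin.snoc_last]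
          at h0 h1 hcol
        have hyw := hc.eq_of_color_eq_s19 h0 h1 hcol
        subst hyw
        first
          | exact ha h0.symm
          | exact hw h.of_cons_snoc
          | exact hy rfl
    _ = (if IsHomCycle G w then (∑ x, (if G.Adj (w 0) x then
          ((G.degree x : ℝ))⁻¹ * ((G.degree (w 0) : ℝ))⁻¹ else 0)) * P else 0) := by
      simp only [Finset.sum_ite_eq', Finset.mem_univ, if_true]
      split_ifs
      · rw [Finset.sum_mul]
      · simp
    _ ≤ (if IsHomCycle G w then P else 0) / (G.minDegree : ℝ) := by
      split_ifs
      · rw [div_eq_inv_mul]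
        exact mul_le_mul_of_nonneg_right (sum_adj_inv_degree_mul_inv_degree_le G hδ _) hP0
      · simp

/-- For a finite properly edge-coloured graph `G` with `δ(G) > 0` and `k ≥ 2`:
`h_{2k}(1, 2k) ≤ h_{2k-2} / δ(G)`. (Here `h_{2k}(1, 2k)` compares the colours of the
edges `u_0 u_1` and `u_{2k-1} u_0`, i.e. `homCyclePairSum` with `0`-based edge indices
`0` and `2k-1`.) -/
theorem homCyclePairSum_le_homCycleSum_div_minDegree {V : Type} [Fintype V]
    (G : SimpleGraph V) [DecidableRel G.Adj] (hδ : 0 < G.minDegree)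
    {β : Type} (c : Sym2 V → β) (hc : IsProperEdgeColoring G c)
    (k : ℕ) (hk : 2 ≤ k) :
    homCyclePairSum G c (m := 2 * k) ⟨0, by omega⟩ ⟨2 * k - 1, by omega⟩ ≤
      homCycleSum G (2 * k - 2) / (G.minDegree : ℝ) := by
  obtain ⟨p, hp⟩ : ∃ p, 2 * k = p + 3 := ⟨2 * k - 3, by omega⟩
  have hp' : 2 * k - 2 = p + 1 := by omega
  rw [hp']
  generalize_proofs h₀ h₁
  have hl : 2 * k - 1 = p + 2 := by omega
  simp only [hl] at h₁ ⊢
  generalize 2 * k = m at *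
  subst hp
  exact homCyclePairSum_zero_last_le G hδ c hc p
end
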